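/- arXiv:1302.2486 — 3 statements merged into one kernel-verified Lean document; each statement's English description precedes it below -/
import Mathlib

section
/- If a ∈ Δ(r) for some r ∈ ℚ∩(0,1), then φ(a) = π((ω_r^+)^∞). Consequently φ is constant on each interval Δ(r). -/
noncomputable section

/-- The doubling map. -/
def Dbl (x : ℝ) : ℝ := if x ≤ 1/2 then 2*x else 2*x - 1

/-- Survivor set `𝒥(a,b)`. -/
def J (a b : ℝ) : Set ℝ := {x ∈ Set.Icc (0:ℝ) 1 | ∀ n : ℕ, Dbl^[n] x ∉ Set.Ioo a b}

/-- The shift on binary sequences. -/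
def shft (x : ℕ → Bool) : ℕ → Bool := fun n => x (n+1)

/-- Binary expansion value. -/
def piMap (w : ℕ → Bool) : ℝ := ∑' n : ℕ, (if w n then (1:ℝ) else 0) / 2 ^ (n+1)

/-- Strict lexicographic order on binary sequences. -/
def seqLt (u v : ℕ → Bool) : Prop := ∃ n, (∀ i < n, u i = v i) ∧ u n < v n

def seqLe (u v : ℕ → Bool) : Prop := seqLt u v ∨ u = v

/-- Periodic sequence `w^∞` associated with a finite word. -/
def per (w : List Bool) : ℕ → Bool := fun n => w.getD (n % w.length) false

/-- Concatenation of a finite word and an infinite sequence. -/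
def cat (w : List Bool) (x : ℕ → Bool) : ℕ → Bool :=
  fun n => if n < w.length then w.getD n false else x (n - w.length)

/-- A finite word is balanced. -/
def BalancedWord (l : List Bool) : Prop :=
  ∀ u v : List Bool, u <:+: l → v <:+: l → u.length = v.length →
    (u.count true : ℤ) - (v.count true : ℤ) ≤ 1

/-- A finite word is cyclically balanced. -/
def CycBalanced (w : List Bool) : Prop := BalancedWord (w ++ w)

def OmegaSet (r : ℚ) (b : Bool) : Set (List Bool) :=
  {w | w.length = r.den ∧ w.count true = r.num.toNat ∧ CycBalanced w ∧ w.head? = some b}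

/-- `w` is the lexicographically largest cyclically balanced word of length `q`
with `p` ones beginning with 0, where `r = p/q` in lowest terms. -/
def IsOmegaMinus (r : ℚ) (w : List Bool) : Prop :=
  w ∈ OmegaSet r false ∧ ∀ v ∈ OmegaSet r false, v = w ∨ List.Lex (· < ·) v w

/-- `w` is the lexicographically smallest cyclically balanced word of length `q`
with `p` ones beginning with 1. -/
def IsOmegaPlus (r : ℚ) (w : List Bool) : Prop :=
  w ∈ OmegaSet r true ∧ ∀ v ∈ OmegaSet r true, v = w ∨ List.Lex (· < ·) w v

open Classical in
def omegaMinus (r : ℚ) : List Bool :=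
  if h : ∃ w, IsOmegaMinus r w then h.choose else []

open Classical in
def omegaPlus (r : ℚ) : List Bool :=
  if h : ∃ w, IsOmegaPlus r w then h.choose else []

/-- The substitution `ρ_r` applied to a word. -/
def substR (r : ℚ) (w : List Bool) : List Bool :=
  (w.map (fun b => if b then omegaPlus r else omegaMinus r)).flatten

/-- `s_n = ρ_{r_1}∘⋯∘ρ_{r_n}(0)`. -/
def sWord : List ℚ → List Bool
  | [] => [false]
  | r :: rs => substR r (sWord rs)

/-- `t_n = ρ_{r_1}∘⋯∘ρ_{r_n}(1)`. -/
def tWord : List ℚ → List Bool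
  | [] => [true]
  | r :: rs => substR r (tWord rs)

/-- `Δ(r_1,…,r_n) = [π(s_n^∞), π(s_n t_n^∞)]`. -/
def DeltaI (rs : List ℚ) : Set ℝ :=
  Set.Icc (piMap (per (sWord rs))) (piMap (cat (sWord rs) (per (tWord rs))))

/-- `Δ̃(r_1,…,r_n) = [π(s_n t_n s_n^∞), π(s_n t_n^∞)]`. -/
def DeltaTilde (rs : List ℚ) : Set ℝ :=
  Set.Icc (piMap (cat (sWord rs) (cat (tWord rs) (per (sWord rs)))))
    (piMap (cat (sWord rs) (per (tWord rs))))

/-- The exceptional set `𝒮`. -/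
def Scal : Set ℝ :=
  Set.Ioo (1/4 : ℝ) (1/2) \ ⋃ r ∈ {r : ℚ | 0 < r ∧ r < 1}, DeltaI [r]

/-- `φ(a)`. -/
def phi (a : ℝ) : ℝ := sSup {b | b ∈ Set.Ioo a 1 ∧ J a b ≠ ({0, 1} : Set ℝ)}

/-- `χ(a)`. -/
def chi (a : ℝ) : ℝ := sSup {b | b ∈ Set.Ioo a 1 ∧ ¬ (J a b).Countable}

/-- `s_n` built from the first `m` entries of an infinite sequence of rationals. -/
def sWordN (r : ℕ → ℚ) (m : ℕ) : List Bool := sWord (List.ofFn fun i : Fin m => r i)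

def tWordN (r : ℕ → ℚ) (m : ℕ) : List Bool := tWord (List.ofFn fun i : Fin m => r i)

/-- `𝔰(𝐫)`, the coordinatewise limit of `ρ_{r_1}⋯ρ_{r_n}(0)`. -/
def sLim (r : ℕ → ℚ) : ℕ → Bool := fun k => (sWordN r (k+1)).getD k false

/-- `𝔱(𝐫)`. -/
def tLim (r : ℕ → ℚ) : ℕ → Bool := fun k => (tWordN r (k+1)).getD k false

/-! ### Lists and mechanical words -/

/-- Digit sequence of slope `p/q` and intercept `k/q`. -/
def mdig (p q k : ℕ) (n : ℕ) : Bool := decide ((n * p + k) / q < ((n + 1) * p + k) / q)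

def mword (p q k : ℕ) : List Bool := (List.range q).map (mdig p q k)

lemma mdig_step (p q k n : ℕ) (hq : 0 < q) (hpq : p ≤ q) :
    ((n + 1) * p + k) / q = (n * p + k) / q + (if mdig p q k n then 1 else 0) := by
  have h1 : (n * p + k) / q ≤ ((n + 1) * p + k) / q :=
    Nat.div_le_div_right (by nlinarith)
  have h2 : ((n + 1) * p + k) / q ≤ (n * p + k) / q + 1 := by
    rw [← Nat.add_div_right _ hq]
    exact Nat.div_le_div_right (by nlinarith)
  unfold mdig
  by_cases h : (n * p + k) / q < ((n + 1) * p + k) / q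
  · simp only [h, decide_true, if_true]; omega
  · simp only [h, decide_false]; simp; omega

lemma mdig_periodic (p q k n : ℕ) (hq : 0 < q) : mdig p q k (n + q) = mdig p q k n := by
  unfold mdig
  have h1 : (n + q) * p + k = (n * p + k) + q * p := by ring
  have h2 : (n + q + 1) * p + k = ((n + 1) * p + k) + q * p := by ring
  rw [h1, h2, Nat.add_mul_div_left _ _ hq, Nat.add_mul_div_left _ _ hq]
  simp

lemma mdig_mod (p q k n : ℕ) (hq : 0 < q) : mdig p q k (n % q) = mdig p q k n := by
  conv_rhs => rw [← Nat.mod_add_div n q]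
  generalize n / q = m
  induction m with
  | zero => simp
  | succ m ih => rw [Nat.mul_succ, ← add_assoc, mdig_periodic _ _ _ _ hq, ← ih]

lemma mword_length (p q k : ℕ) : (mword p q k).length = q := by simp [mword]

lemma mword_getD (p q k n : ℕ) (hn : n < q) : (mword p q k).getD n false = mdig p q k n := by
  simp [mword, List.getD, hn]

lemma per_mword (p q k : ℕ) (hq : 0 < q) : per (mword p q k) = mdig p q k := by
  funext n
  unfold per
  rw [mword_length, mword_getD _ _ _ _ (Nat.mod_lt _ hq), mdig_mod _ _ _ _ hq]

lemma count_range_mdig (p q k n : ℕ) (hq : 0 < q) (hpq : p ≤ q) :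
    k / q + ((List.range n).map (mdig p q k)).count true = (n * p + k) / q := by
  induction n with
  | zero => simp
  | succ n ih =>
    rw [List.range_succ, List.map_append, List.count_append, ← add_assoc, ih,
      mdig_step p q k n hq hpq]
    cases h : mdig p q k n <;> simp [h]

lemma mword_append (p q k : ℕ) (hq : 0 < q) :
    mword p q k ++ mword p q k = (List.range (q + q)).map (mdig p q k) := by
  rw [List.range_add, List.map_append, List.map_map]
  unfold mword
  congr 1
  apply List.map_congr_left
  intro a _
  simp only [Function.comp]
  rw [add_comm, mdig_periodic _ _ _ _ hq]

lemma take_range_map (f : ℕ → Bool) (n N : ℕ) (h : n ≤ N) :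
    ((List.range N).map f).take n = (List.range n).map f := by
  rw [← List.map_take, List.take_range, min_eq_left h]

lemma infix_count (l u : List Bool) (h : u <:+: l) :
    ∃ i, i + u.length ≤ l.length ∧ (l.take (i + u.length)).count true =
      (l.take i).count true + u.count true := by
  obtain ⟨s, t, rfl⟩ := h
  refine ⟨s.length, by simp, ?_⟩
  rw [List.append_assoc, List.take_left]
  rw [← List.append_assoc, ← List.length_append, List.take_left, List.count_append]

lemma floor_balance (p q k i j m : ℕ) (hq : 0 < q) :
    (((i + m) * p + k) / q : ℕ) + ((j * p + k) / q : ℕ) ≤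
      ((j + m) * p + k) / q + (i * p + k) / q + 1 := by
  have h1 := Nat.div_add_mod ((i + m) * p + k) q
  have h2 := Nat.div_add_mod (j * p + k) q
  have h3 := Nat.div_add_mod ((j + m) * p + k) q
  have h4 := Nat.div_add_mod (i * p + k) q
  have g3 := Nat.mod_lt ((j + m) * p + k) hq
  have g4 := Nat.mod_lt (i * p + k) hq
  by_contra! hc
  have : q * (((j + m) * p + k) / q + (i * p + k) / q + 2) ≤
    q * (((i + m) * p + k) / q + ((j * p + k) / q)) := Nat.mul_le_mul_left _ hc
  generalize ((i + m) * p + k) / q = A1 at *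
  generalize (j * p + k) / q = A2 at *
  generalize ((j + m) * p + k) / q = A3 at *
  generalize (i * p + k) / q = A4 at *
  generalize ((i + m) * p + k) % q = B1 at *
  generalize (j * p + k) % q = B2 at *
  generalize ((j + m) * p + k) % q = B3 at *
  generalize (i * p + k) % q = B4 at *
  nlinarith

lemma mword_cyc (p q k : ℕ) (hq : 0 < q) (hpq : p ≤ q) : CycBalanced (mword p q k) := by
  intro u v hu hv huv
  rw [mword_append _ _ _ hq] at hu hv
  obtain ⟨i, hi, hi'⟩ := infix_count _ _ hu
  obtain ⟨j, hj, hj'⟩ := infix_count _ _ hv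
  simp only [List.length_map, List.length_range] at hi hj
  rw [take_range_map _ _ _ (by omega), take_range_map _ _ _ (by omega)] at hi' hj'
  have a1 := count_range_mdig p q k (i + u.length) hq hpq
  have a2 := count_range_mdig p q k i hq hpq
  have a3 := count_range_mdig p q k (j + v.length) hq hpq
  have a4 := count_range_mdig p q k j hq hpq
  have := floor_balance p q k i j u.length hq
  rw [huv] at *
  omega

lemma mword_count (p q k : ℕ) (hq : 0 < q) (hpq : p ≤ q) : (mword p q k).count true = p := by
  have := count_range_mdig p q k q hq hpq
  rw [add_comm (q * p), Nat.add_mul_div_left _ _ hq] at this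
  unfold mword
  omega

lemma mword_take_count (p q k n : ℕ) (hq : 0 < q) (hpq : p ≤ q) (hn : n ≤ q) (hk : k < q) :
    ((mword p q k).take n).count true = (n * p + k) / q := by
  have := count_range_mdig p q k n hq hpq
  rw [Nat.div_eq_of_lt hk] at this
  unfold mword
  rw [take_range_map _ _ _ hn]
  omega

lemma mword_head (p q k : ℕ) (hq : 0 < q) : (mword p q k).head? = some (mdig p q k 0) := by
  obtain ⟨q, rfl⟩ : ∃ q', q = q' + 1 := ⟨q - 1, by omega⟩
  simp [mword, List.range_succ_eq_map]

lemma lex_of_counts (x : List Bool) : ∀ y : List Bool, x.length = y.length →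
    (∀ n, (x.take n).count true ≤ (y.take n).count true) →
    x = y ∨ List.Lex (· < ·) x y := by
  induction x with
  | nil => intro y h _; left; symm; simpa using h.symm
  | cons a x ih =>
    intro y h hc
    cases y with
    | nil => simp at h
    | cons b y =>
      have h1 := hc 1
      have key : a = b → (a :: x = b :: y ∨ List.Lex (· < ·) (a :: x) (b :: y)) := by
        rintro rfl
        rcases ih y (by simpa using h) (fun n => by
          have := hc (n + 1)
          simp only [List.take_succ_cons, List.count_cons] at this
          omega) with h | h
        · left; rw [h]
        · right; exact List.Lex.cons h
      cases a <;> cases b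
      · exact key rfl
      · right; exact List.Lex.rel (by decide)
      · simp at h1
      · exact key rfl

lemma lex_asymm (x : List Bool) : ∀ y : List Bool,
    List.Lex (· < ·) x y → List.Lex (· < ·) y x → False := by
  intro y h
  induction h with
  | nil => intro h; cases h
  | cons h ih => 
    intro h'
    cases h' with
    | cons h' => exact ih h'
    | rel h' => exact lt_irrefl _ h'
  | rel h =>
    intro h'
    cases h' with
    | cons h' => exact lt_irrefl _ h
    | rel h' => exact lt_asymm h h'

/-- Averaging. -/
lemma averaging (C : ℕ → ℤ) (p q m i0 : ℕ) (hi0 : i0 < q) (hm : m ≤ q)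
    (hper : ∀ i ≤ q, C (q + i) = C i + p)
    (hbal : ∀ i j, i < q → j < q → (C (i + m) - C i) - (C (j + m) - C j) ≤ 1) :
    (C (i0 + m) - C i0 - 1) * q < m * p ∧ (m * p : ℤ) < (C (i0 + m) - C i0 + 1) * q := by
  have hs : ∀ m ≤ q, ∑ i ∈ Finset.range q, (C (i + m) - C i) = m * p := by
    intro m
    induction m with
    | zero => simp
    | succ m ih =>
      intro hm
      have h1 := ih (by omega)
      have h2 : ∑ i ∈ Finset.range q, C (i + (m + 1)) = 
          ∑ i ∈ Finset.range q, C (i + m) + C (q + m) - C m := by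
        have e1 := Finset.sum_range_succ (fun i => C (i + m)) q
        have e2 := Finset.sum_range_succ' (fun i => C (i + m)) q
        simp only [zero_add] at e2
        have e3 : ∑ i ∈ Finset.range q, C (i + (m + 1)) = ∑ i ∈ Finset.range q, C (i + 1 + m) :=
          Finset.sum_congr rfl (fun i _ => by congr 1; ring)
        rw [e3]; linarith
      rw [Finset.sum_sub_distrib] at *
      rw [h2, hper m (by omega)]
      push_cast
      linarith
  have hs := hs m hm
  constructor
  · have : ∑ i ∈ Finset.range q, (C (i0 + m) - C i0 - 1) <
      ∑ i ∈ Finset.range q, (C (i + m) - C i) := by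
      apply Finset.sum_lt_sum
      · intro i hi
        have := hbal i0 i hi0 (Finset.mem_range.1 hi)
        linarith
      · exact ⟨i0, Finset.mem_range.2 hi0, by linarith⟩
    rw [hs, Finset.sum_const, Finset.card_range, nsmul_eq_mul] at this
    linarith
  · have : ∑ i ∈ Finset.range q, (C (i + m) - C i) <
      ∑ i ∈ Finset.range q, (C (i0 + m) - C i0 + 1) := by
      apply Finset.sum_lt_sum
      · intro i hi
        have := hbal i i0 (Finset.mem_range.1 hi) hi0
        linarith
      · exact ⟨i0, Finset.mem_range.2 hi0, by linarith⟩
    rw [hs, Finset.sum_const, Finset.card_range, nsmul_eq_mul] at this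
    linarith

lemma take_count_append (l : List Bool) (i m : ℕ) :
    (l.take (i + m)).count true = (l.take i).count true + ((l.drop i).take m).count true := by
  rw [List.take_add, List.count_append]

lemma word_bound (v : List Bool) (p q n : ℕ) (hq : 2 ≤ q) (hl : v.length = q)
    (hc : v.count true = p) (hv : CycBalanced v) (hn : n + 1 ≤ q) :
    let D : ℤ := ((v.take (n + 1)).count true : ℤ) - ((v.take 1).count true : ℤ)
    (D - 1) * q < n * p ∧ (n * p : ℤ) < (D + 1) * q := by
  have h := averaging (fun i => (((v ++ v).take i).count true : ℤ)) p q n 1 (by omega) (by omega)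
    (by
      intro i hi
      rw [← hl, List.take_length_add_append, List.count_append, hc,
        List.take_append_of_le_length (by omega)]
      push_cast; ring)
    (by
      intro i j hi hj
      rw [take_count_append, take_count_append _ j]
      have := hv (((v ++ v).drop i).take n) (((v ++ v).drop j).take n)
        ((List.take_prefix _ _).isInfix.trans (List.drop_suffix _ _).isInfix)
        ((List.take_prefix _ _).isInfix.trans (List.drop_suffix _ _).isInfix)
        (by simp; omega)
      push_cast
      linarith)
  rw [List.take_append_of_le_length (by omega), List.take_append_of_le_length (by omega),
    add_comm 1 n] at h
  exact h

lemma take_one_count (v : List Bool) (b : Bool) (h : v.head? = some b) :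
    (v.take 1).count true = if b then 1 else 0 := by
  cases v with
  | nil => simp at h
  | cons a v => simp at h; subst h; cases a <;> simp

lemma isOmegaMinus_mword (r : ℚ) (p q : ℕ) (hq : q = r.den) (hp : p = r.num.toNat)
    (hp0 : 0 < p) (hpq : p < q) : IsOmegaMinus r (mword p q (q - p - 1)) := by
  have hd : mdig p q (q - p - 1) 0 = false := by
    unfold mdig
    rw [Nat.div_eq_of_lt (by omega), Nat.div_eq_of_lt (by omega)]; simp
  refine ⟨⟨by rw [mword_length, hq], by rw [mword_count _ _ _ (by omega) hpq.le, hp],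
    mword_cyc _ _ _ (by omega) hpq.le, by rw [mword_head _ _ _ (by omega), hd]⟩, ?_⟩
  rintro v ⟨h1, h2, h3, h4⟩
  rw [← hq] at h1
  rw [← hp] at h2
  apply lex_of_counts _ _ (by rw [h1, mword_length])
  intro n
  rcases Nat.eq_zero_or_pos n with rfl | hn
  · simp
  by_cases hnq : q ≤ n
  · rw [List.take_of_length_le (by omega), List.take_of_length_le (by rw [mword_length]; omega),
      h2, mword_count _ _ _ (by omega) hpq.le]
  obtain ⟨n, rfl⟩ : ∃ n', n = n' + 1 := ⟨n - 1, by omega⟩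
  rw [mword_take_count _ _ _ _ (by omega) hpq.le (by omega) (by omega)]
  have := (word_bound v p q n (by omega) h1 h2 h3 (by omega)).1
  rw [take_one_count _ _ h4] at this
  rw [Nat.le_div_iff_mul_le (by omega)]
  have e : (n + 1) * p + (q - p - 1) = n * p + q - 1 := by
    rw [Nat.add_mul]; omega
  rw [e]
  have e2 : (List.count true (List.take (n + 1) v)) * q < n * p + q := by
    zify
    simp at this
    linarith
  omega

lemma isOmegaPlus_mword (r : ℚ) (p q : ℕ) (hq : q = r.den) (hp : p = r.num.toNat)
    (hp0 : 0 < p) (hpq : p < q) : IsOmegaPlus r (mword p q (q - p)) := by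
  have hd : mdig p q (q - p) 0 = true := by
    unfold mdig
    rw [Nat.div_eq_of_lt (by omega)]
    have : (0 + 1) * p + (q - p) = q := by omega
    rw [this, Nat.div_self (by omega)]; simp
  refine ⟨⟨by rw [mword_length, hq], by rw [mword_count _ _ _ (by omega) hpq.le, hp],
    mword_cyc _ _ _ (by omega) hpq.le, by rw [mword_head _ _ _ (by omega), hd]⟩, ?_⟩
  rintro v ⟨h1, h2, h3, h4⟩
  rw [← hq] at h1
  rw [← hp] at h2
  rw [eq_comm]
  apply lex_of_counts _ _ (by rw [h1, mword_length])
  intro n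
  rcases Nat.eq_zero_or_pos n with rfl | hn
  · simp
  by_cases hnq : q ≤ n
  · rw [List.take_of_length_le (by rw [mword_length]; omega), List.take_of_length_le (by omega),
      h2, mword_count _ _ _ (by omega) hpq.le]
  obtain ⟨n, rfl⟩ : ∃ n', n = n' + 1 := ⟨n - 1, by omega⟩
  rw [mword_take_count _ _ _ _ (by omega) hpq.le (by omega) (by omega)]
  have := (word_bound v p q n (by omega) h1 h2 h3 (by omega)).2
  rw [take_one_count _ _ h4] at this
  rw [← Nat.lt_succ_iff, Nat.div_lt_iff_lt_mul (by omega)]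
  have e : (n + 1) * p + (q - p) = n * p + q := by
    rw [Nat.add_mul]; omega
  rw [e]
  zify
  simp at this
  linarith

lemma omegaMinus_eq (r : ℚ) (w : List Bool) (h : IsOmegaMinus r w) : omegaMinus r = w := by
  have he : ∃ w, IsOmegaMinus r w := ⟨w, h⟩
  unfold omegaMinus
  rw [dif_pos he]
  have h' := he.choose_spec
  rcases h.2 _ h'.1 with h1 | h1
  · exact h1
  rcases h'.2 _ h.1 with h2 | h2
  · exact h2.symm
  exact (lex_asymm _ _ h1 h2).elim

lemma omegaPlus_eq (r : ℚ) (w : List Bool) (h : IsOmegaPlus r w) : omegaPlus r = w := by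
  have he : ∃ w, IsOmegaPlus r w := ⟨w, h⟩
  unfold omegaPlus
  rw [dif_pos he]
  have h' := he.choose_spec
  rcases h.2 _ h'.1 with h1 | h1
  · exact h1
  rcases h'.2 _ h.1 with h2 | h2
  · exact h2.symm
  exact (lex_asymm _ _ h1 h2).elim

/-! ### The function `gfun` -/

def gfun (p q k : ℕ) : ℝ := ∑' n : ℕ, (((n * p + k) / q : ℕ) : ℝ) / 2 ^ (n + 1)

lemma gsum (p q k : ℕ) :
    Summable fun n : ℕ => (((n * p + k) / q : ℕ) : ℝ) / 2 ^ (n + 1) := by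
  have h1 : Summable fun n : ℕ => ((n : ℝ) ^ 1 * (1 / 2 : ℝ) ^ n) :=
    summable_pow_mul_geometric_of_norm_lt_one 1 (by norm_num)
  have h2 : Summable fun n : ℕ => ((1 / 2 : ℝ) ^ n) :=
    summable_geometric_of_lt_one (by norm_num) (by norm_num)
  refine Summable.of_nonneg_of_le (fun n => by positivity) (fun n => ?_)
    (((h1.mul_left (p : ℝ)).add (h2.mul_left (k : ℝ))))
  have : (((n * p + k) / q : ℕ) : ℝ) ≤ n * p + k := by
    exact_mod_cast Nat.div_le_self _ _
  rw [div_le_iff₀ (by positivity), pow_one, one_div, inv_pow]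
  have h3 : (0 : ℝ) < 2 ^ n := by positivity
  have e : (p * (n * (2 ^ n)⁻¹) + k * (2 ^ n)⁻¹) * 2 ^ (n + 1) = 2 * ((n : ℝ) * p + k) := by
    field_simp
    ring
  rw [e]
  have : (0 : ℝ) ≤ n * p + k := by positivity
  linarith

lemma g_mono (p q : ℕ) {k l : ℕ} (h : k ≤ l) : gfun p q k ≤ gfun p q l := by
  apply Summable.tsum_le_tsum _ (gsum p q k) (gsum p q l)
  intro n
  gcongr

lemma half_hasSum : HasSum (fun n : ℕ => (1 : ℝ) / 2 ^ (n + 1)) 1 := by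
  have := hasSum_geometric_two' (1 : ℝ)
  refine this.congr_fun ?_ |> fun h => h
  intro n
  simp [pow_succ]; ring

lemma g_add_q (p q k : ℕ) (hq : 0 < q) : gfun p q (k + q) = gfun p q k + 1 := by
  have h := ((gsum p q k).hasSum.add half_hasSum).tsum_eq
  rw [gfun, gfun, ← h]
  apply tsum_congr
  intro n
  rw [← add_assoc, Nat.add_div_right _ hq]
  push_cast
  ring

lemma g_add_p (p q k : ℕ) : gfun p q (k + p) = 2 * gfun p q k - ((k / q : ℕ) : ℝ) := by
  have h := (gsum p q k).tsum_eq_zero_add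
  have h2 : gfun p q (k + p) = 2 * ∑' n : ℕ, ((((n + 1) * p + k) / q : ℕ) : ℝ) / 2 ^ (n + 1 + 1) := by
    rw [gfun, ← tsum_mul_left]
    apply tsum_congr
    intro n
    have : n * p + (k + p) = (n + 1) * p + k := by ring
    rw [this, pow_succ _ (n + 1)]
    field_simp
  rw [h2]
  rw [gfun, h]
  simp
  ring

lemma g_nonneg (p q k : ℕ) : 0 ≤ gfun p q k := tsum_nonneg (fun n => by positivity)

lemma g0_pos (p q : ℕ) (hp : 0 < p) (hq : 0 < q) : 0 < gfun p q 0 := by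
  apply (gsum p q 0).tsum_pos (fun n => by positivity) q
  simp [Nat.mul_div_cancel_left _ hq]
  exact hp

lemma g_lt (p q : ℕ) (hq : 0 < q) : gfun p q (q - 1) < gfun p q 0 + 1 / 2 := by
  have hs : HasSum (fun n : ℕ => if n = 0 then (1 / 2 : ℝ) else 0) (1 / 2) :=
    hasSum_ite_eq 0 (1 / 2)
  have h := (((gsum p q 0).hasSum.add half_hasSum).sub hs)
  have : gfun p q 0 + 1 / 2 = gfun p q 0 + 1 - 1 / 2 := by ring
  rw [this]
  refine hasSum_lt (i := q) ?_ ?_ (gsum p q (q - 1)).hasSum h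
  · intro n
    simp only
    by_cases hn : n = 0
    · subst hn
      rw [Nat.div_eq_of_lt (by omega)]; simp
    · rw [if_neg hn, sub_zero, ← add_div]
      gcongr
      have : (n * p + (q - 1)) / q ≤ (n * p + 0) / q + 1 := by
        rw [← Nat.add_div_right _ hq]
        exact Nat.div_le_div_right (by omega)
      exact_mod_cast this
  · rw [if_neg (by omega), sub_zero, ← add_div]
    gcongr
    rw [add_comm (q * p), Nat.add_mul_div_left _ _ hq, add_zero, Nat.mul_div_cancel_left _ hq,
      Nat.div_eq_of_lt (by omega)]
    push_cast; linarith

lemma piSum (w : ℕ → Bool) : Summable fun n : ℕ => (if w n then (1 : ℝ) else 0) / 2 ^ (n + 1) := by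
  refine Summable.of_nonneg_of_le (fun n => by positivity) (fun n => ?_) half_hasSum.summable
  gcongr
  split_ifs <;> norm_num

lemma piMap_mdig (p q k : ℕ) (hq : 0 < q) (hpq : p ≤ q) (hk : k < q) :
    piMap (mdig p q k) = gfun p q k := by
  have h := ((gsum p q (k + p)).hasSum.sub (gsum p q k).hasSum).tsum_eq
  have h2 : piMap (mdig p q k) = gfun p q (k + p) - gfun p q k := by
    rw [gfun, gfun, ← h]
    apply tsum_congr
    intro n
    have := mdig_step p q k n hq hpq
    have e : n * p + (k + p) = (n + 1) * p + k := by ring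
    rw [e, this]
    push_cast
    ring
  rw [h2, g_add_p, Nat.div_eq_of_lt hk]
  simp; ring

lemma div_pred (x q : ℕ) (h : ¬ q ∣ x + 1) : (x + 1) / q = x / q := by
  rw [Nat.succ_div, if_neg h]; rfl

lemma mdig_eq (p q n : ℕ) (hcop : Nat.Coprime p q) (hpq : p < q) (hn : 2 ≤ n)
    (hnq : n < q) : mdig p q (q - p - 1) n = mdig p q (q - p) n := by
  have key : ∀ m, 1 ≤ m → m < q →
      ((m + 1) * p + (q - p)) / q = ((m + 1) * p + (q - p - 1)) / q := by
    intro m hm hmq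
    have e : (m + 1) * p + (q - p) = (m + 1) * p + (q - p - 1) + 1 := by omega
    have e2 : (m + 1) * p + (q - p - 1) + 1 = m * p + q := by
      rw [Nat.add_mul]; omega
    rw [e]
    apply div_pred
    rw [e2]
    intro hd
    have hd := (Nat.dvd_add_left (dvd_refl q)).1 hd
    have := Nat.le_of_dvd (by omega) (hcop.symm.dvd_of_dvd_mul_right hd)
    omega
  unfold mdig
  rw [key n (by omega) hnq]
  have := key (n - 1) (by omega) (by omega)
  rw [show n - 1 + 1 = n by omega] at this
  rw [this]

lemma cat_val (p q : ℕ) (hcop : Nat.Coprime p q) (hp : 0 < p) (hpq : p < q) :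
    piMap (cat (mword p q (q - p - 1)) (per (mword p q (q - p)))) = gfun p q (q - p) - 1 / 4 := by
  rw [per_mword _ _ _ (by omega), ← piMap_mdig _ _ _ (by omega) hpq.le (by omega)]
  set c := cat (mword p q (q - p - 1)) (mdig p q (q - p)) with hc
  have cl : ∀ n, n < q → c n = mdig p q (q - p - 1) n := by
    intro n hn
    simp only [hc, cat, mword_length, if_pos hn, mword_getD _ _ _ _ hn]
  have cg : ∀ n, ¬ n < q → c n = mdig p q (q - p) n := by
    intro n hn
    simp only [hc, cat, mword_length, if_neg hn]
    rw [← mdig_periodic _ _ _ _ (by omega)]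
    congr 1; omega
  have a1 : p + (q - p) = q := by omega
  have hq : 0 < q := by omega
  have c0 : c 0 = false := by
    rw [cl 0 hq]; unfold mdig
    rw [Nat.div_eq_of_lt (by omega), Nat.div_eq_of_lt (by omega)]; simp
  have c1 : c 1 = true := by
    rw [cl 1 (by omega)]; unfold mdig
    rw [Nat.div_eq_of_lt (by omega)]
    simp
    constructor <;> omega
  have t0 : mdig p q (q - p) 0 = true := by
    unfold mdig
    rw [Nat.div_eq_of_lt (by omega)]
    simp
    constructor <;> omega
  have t1 : mdig p q (q - p) 1 = false := by
    unfold mdig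
    have e1 : 1 * p + (q - p) = q := by omega
    have e2 : (1 + 1) * p + (q - p) = p + q := by omega
    rw [e1, e2, Nat.add_div_right _ hq, Nat.div_self hq, Nat.div_eq_of_lt hpq]; simp
  have h := ((piSum (mdig p q (q - p))).hasSum.sub (piSum c).hasSum).tsum_eq
  have h2 : piMap (mdig p q (q - p)) - piMap c = 1 / 4 := by
    unfold piMap
    rw [← h, tsum_eq_sum (s := Finset.range 2)]
    · rw [Finset.sum_range_succ, Finset.sum_range_one, c0, c1, t0, t1]
      norm_num
    · intro n hn
      have hn : 2 ≤ n := by simp at hn; omega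
      have : c n = mdig p q (q - p) n := by
        by_cases hnq : n < q
        · rw [cl n hnq, mdig_eq p q n hcop hpq hn hnq]
        · exact cg n hnq
      rw [this, sub_self]
  linarith

/-! ### Dynamics -/

lemma dbl_lo {x : ℝ} (h : x ≤ 1 / 2) : Dbl x = 2 * x := by unfold Dbl; rw [if_pos h]
lemma dbl_hi {x : ℝ} (h : 1 / 2 < x) : Dbl x = 2 * x - 1 := by
  unfold Dbl; rw [if_neg (not_le.2 h)]

lemma pow_unbdd (f : ℕ → ℝ) (h0 : 0 < f 0) (hs : ∀ n, f (n + 1) = 2 * f n) (hb : ∀ n, f n ≤ 1) :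
    False := by
  have h : ∀ n, f n = 2 ^ n * f 0 := by
    intro n
    induction n with
    | zero => simp
    | succ n ih => rw [hs, ih]; ring
  obtain ⟨n, hn⟩ := pow_unbounded_of_one_lt (1 / f 0) (by norm_num : (1 : ℝ) < 2)
  rw [div_lt_iff₀ h0] at hn
  have := hb n
  rw [h] at this
  linarith

/-- No orbit in `(0,1)` avoids the hole `(a,b)` when `b` exceeds the critical value. -/
lemma no_orbit (p q : ℕ) (hp : 0 < p) (hpq : p < q) (a b : ℝ)
    (ha : a ≤ gfun p q (q - p) - 1 / 4) (hb : gfun p q (q - p) < b)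
    (ha2 : a < 1 / 2) (hb2 : 1 / 2 < gfun p q (q - p))
    (x : ℕ → ℝ) (hx0 : 0 < x 0) (hx1 : x 0 < 1) (hx : ∀ n, x (n + 1) = Dbl (x n))
    (hh : ∀ n, x n ≤ a ∨ b ≤ x n) : False := by
  have hq : 0 < q := by omega
  have lo : ∀ n, x n ≤ a → x (n + 1) = 2 * x n := fun n h => by rw [hx, dbl_lo (by linarith)]
  have hi : ∀ n, b ≤ x n → x (n + 1) = 2 * x n - 1 := fun n h => by
    rw [hx, dbl_hi (by linarith)]
  have h01 : ∀ n, 0 < x n ∧ x n < 1 := by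
    intro n
    induction n with
    | zero => exact ⟨hx0, hx1⟩
    | succ n ih =>
      rcases hh n with h | h
      · rw [lo n h]; constructor <;> linarith
      · rw [hi n h]; constructor <;> linarith
  have htau : 2 * gfun p q (q - p) = gfun p q 0 + 1 := by
    have h1 := g_add_p p q (q - p)
    rw [Nat.div_eq_of_lt (by omega), Nat.sub_add_cancel hpq.le] at h1
    have h2 := g_add_q p q 0 hq
    rw [zero_add] at h2
    simp at h1
    linarith
  -- a visit to the right part
  have e1 : ∃ n, b ≤ x n := by
    by_contra! hc
    refine pow_unbdd x hx0 (fun n => lo n ?_) (fun n => (h01 n).2.le)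
    exact (hh n).resolve_right (not_le.2 (hc n))
  obtain ⟨n, hn⟩ := e1
  have e2 : ∃ m, x (n + m) ≤ a := by
    by_contra! hc
    refine pow_unbdd (fun m => 1 - x (n + m)) (by have := (h01 (n + 0)).2; linarith)
      (fun m => ?_) (fun m => by have := (h01 (n + m)).1; linarith)
    have := hi (n + m) ((hh (n + m)).resolve_left (not_le.2 (hc m)))
    rw [← add_assoc, this]; ring
  classical
  obtain ⟨m, hm, hmin⟩ : ∃ m, x (n + m) ≤ a ∧ ∀ j < m, ¬ x (n + j) ≤ a :=
    ⟨Nat.find e2, Nat.find_spec e2, fun j hj => Nat.find_min e2 hj⟩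
  have hm0 : m ≠ 0 := by
    rintro rfl
    rw [add_zero] at hm
    linarith
  obtain ⟨m, rfl⟩ := Nat.exists_eq_succ_of_ne_zero hm0
  have hb' := (hh (n + m)).resolve_left (hmin m (Nat.lt_succ_self m))
  have hs := hi (n + m) hb'
  have hs' : x (n + m + 1) ≤ a := hm
  set N := n + m + 1 with hN
  have hstart : gfun p q 0 < x N := by rw [hs]; linarith
  -- the upper barrier
  have hup : ∀ j, x (N + j) ≤ gfun p q 0 + 1 / 2 := by
    intro j
    induction j with
    | zero => have := g_nonneg p q 0; rw [add_zero]; linarith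
    | succ j ih =>
      rw [← add_assoc]
      rcases hh (N + j) with h | h
      · rw [lo _ h]; linarith
      · rw [hi _ h]; have := (h01 (N + j)).2; linarith
  have e3 : ∃ k, x N ≤ gfun p q (k + 1) := by
    refine ⟨q - 1, ?_⟩
    rw [Nat.sub_add_cancel hq]
    have h2 := g_add_q p q 0 hq
    rw [zero_add] at h2
    have := hup 0
    rw [add_zero] at this
    linarith
  have hlt : ∀ k y, gfun p q k < y → y ≤ gfun p q 0 + 1 / 2 → k < q := by
    intro k y h1 h2
    by_contra! hc
    have h3 := g_mono p q hc
    have h4 := g_add_q p q 0 hq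
    rw [zero_add] at h4
    linarith
  have step : ∀ j k, gfun p q k < x (N + j) → x (N + j) ≤ gfun p q (k + 1) →
      ∃ k', gfun p q k' < x (N + j + 1) ∧ x (N + j + 1) ≤ gfun p q (k' + 1) ∧
        x (N + j + 1) - gfun p q k' = 2 * (x (N + j) - gfun p q k) := by
    intro j k h1 h2
    have hk : k < q := hlt k _ h1 (hup j)
    have gk := g_add_p p q k
    rw [Nat.div_eq_of_lt hk] at gk
    simp at gk
    rcases hh (N + j) with h | h
    · have hk2 : k < q - p := by
        by_contra! hc
        have := g_mono p q hc
        linarith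
      have gk1 := g_add_p p q (k + 1)
      rw [Nat.div_eq_of_lt (by omega)] at gk1
      simp at gk1
      refine ⟨k + p, ?_, ?_, ?_⟩
      · rw [lo _ h]; linarith
      · rw [lo _ h, show k + p + 1 = k + 1 + p by ring]; linarith
      · rw [lo _ h]; linarith
    · have hk2 : q - p ≤ k := by
        by_contra! hc
        have := g_mono p q (show k + 1 ≤ q - p by omega)
        linarith
      have e : k + p = (k + p - q) + q := by omega
      have g1 := g_add_q p q (k + p - q) hq
      rw [← e] at g1
      refine ⟨k + p - q, ?_, ?_, ?_⟩
      · rw [hi _ h]; linarith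
      · rw [hi _ h]
        by_cases hk3 : k + 1 = q
        · have : k + p - q + 1 = 0 + p := by omega
          rw [this, g_add_p]
          have := hup j
          simp
          linarith
        · have gk1 := g_add_p p q (k + 1)
          rw [Nat.div_eq_of_lt (by omega)] at gk1
          simp at gk1
          have g2 := g_add_q p q (k + p - q + 1) hq
          rw [show k + p - q + 1 + q = k + 1 + p by omega] at g2
          linarith
      · rw [hi _ h]; linarith
  have hstart2 : ∃ k, gfun p q k < x N ∧ x N ≤ gfun p q (k + 1) := by
    obtain ⟨k, hk, hkmin⟩ : ∃ k, x N ≤ gfun p q (k + 1) ∧ ∀ j < k, ¬ x N ≤ gfun p q (j + 1) :=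
      ⟨Nat.find e3, Nat.find_spec e3, fun j hj => Nat.find_min e3 hj⟩
    refine ⟨k, ?_, hk⟩
    cases k with
    | zero => exact hstart
    | succ k => exact not_le.1 (hkmin k (Nat.lt_succ_self k))
  obtain ⟨k0, hk0, hk0'⟩ := hstart2
  have all : ∀ j, ∃ k, gfun p q k < x (N + j) ∧ x (N + j) ≤ gfun p q (k + 1) ∧
      x (N + j) - gfun p q k = 2 ^ j * (x N - gfun p q k0) := by
    intro j
    induction j with
    | zero => exact ⟨k0, hk0, hk0', by simp⟩
    | succ j ih =>
      obtain ⟨k, h1, h2, h3⟩ := ih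
      obtain ⟨k', h1', h2', h3'⟩ := step j k h1 h2
      exact ⟨k', h1', h2', by rw [← add_assoc, h3', h3]; ring⟩
  refine pow_unbdd (fun j => 2 ^ j * (x N - gfun p q k0)) (by simp; linarith)
    (fun j => by ring) (fun j => ?_)
  obtain ⟨k, _, _, h3⟩ := all j
  rw [← h3]
  have := g_nonneg p q k
  have := (h01 (N + j)).2
  linarith

lemma phi_val (p q : ℕ) (hp : 0 < p) (hpq : p < q) (a : ℝ)
    (ha : a ≤ gfun p q (q - p) - 1 / 4) (ha' : gfun p q (q - p - 1) ≤ a) :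
    phi a = gfun p q (q - p) := by
  have hq : 0 < q := by omega
  have htau : 2 * gfun p q (q - p) = gfun p q 0 + 1 := by
    have h1 := g_add_p p q (q - p)
    rw [Nat.div_eq_of_lt (by omega), Nat.sub_add_cancel hpq.le] at h1
    have h2 := g_add_q p q 0 hq
    rw [zero_add] at h2
    simp at h1
    linarith
  have g0 := g0_pos p q hp hq
  have glt := g_lt p q hq
  have g0' : gfun p q 0 < 1 / 2 := by
    have h1 := g_add_p p q 0
    simp at h1
    have := g_mono p q (show p ≤ q - 1 by omega)
    linarith
  have gs : gfun p q (q - p - 1) < 1 / 2 := by linarith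
  have ha0 : 0 ≤ a := (g_nonneg p q _).trans ha'
  apply IsGreatest.csSup_eq
  constructor
  · refine ⟨⟨by linarith, by linarith⟩, ?_⟩
    have hmem : gfun p q (q - p) ∈ J a (gfun p q (q - p)) := by
      refine ⟨⟨by linarith, by linarith⟩, ?_⟩
      have horb : ∀ n, ∃ k < q, Dbl^[n] (gfun p q (q - p)) = gfun p q k := by
        intro n
        induction n with
        | zero => exact ⟨q - p, by omega, rfl⟩
        | succ n ih =>
          obtain ⟨k, hk, h⟩ := ih
          rw [Function.iterate_succ_apply', h]
          have gk := g_add_p p q k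
          rw [Nat.div_eq_of_lt hk] at gk
          simp at gk
          by_cases hk2 : k < q - p
          · have := g_mono p q (show k ≤ q - p - 1 by omega)
            exact ⟨k + p, by omega, by rw [dbl_lo (by linarith), gk]⟩
          · have := g_mono p q (show q - p ≤ k by omega)
            refine ⟨k + p - q, by omega, ?_⟩
            have g1 := g_add_q p q (k + p - q) hq
            rw [show k + p - q + q = k + p by omega] at g1
            rw [dbl_hi (by linarith)]; linarith
      intro n
      obtain ⟨k, hk, h⟩ := horb n
      rw [h]
      rintro ⟨h1, h2⟩
      by_cases hk2 : k < q - p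
      · have := g_mono p q (show k ≤ q - p - 1 by omega)
        linarith
      · have := g_mono p q (show q - p ≤ k by omega)
        linarith
    intro he
    rw [he] at hmem
    rcases hmem with h | h
    · linarith
    · have h : gfun p q (q - p) = 1 := h
      linarith
  · rintro b ⟨⟨hab, hb1⟩, hJ⟩
    by_contra! hb
    apply hJ
    ext x
    constructor
    · rintro ⟨⟨hx0, hx1⟩, hx⟩
      by_contra hne
      have hne0 : x ≠ 0 := fun h => hne (Or.inl h)
      have hne1 : x ≠ 1 := fun h => hne (Or.inr h)
      refine no_orbit p q hp hpq a b ha hb (by linarith) (by linarith) (fun n => Dbl^[n] x)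
        (lt_of_le_of_ne hx0 hne0.symm) (lt_of_le_of_ne hx1 hne1)
        (fun n => Function.iterate_succ_apply' _ _ _) (fun n => ?_)
      have := hx n
      by_contra! hc
      exact this ⟨hc.1, hc.2⟩
    · rintro (h | h)
      · subst h
        refine ⟨by simp, fun n => ?_⟩
        rw [Function.iterate_fixed (by rw [dbl_lo (by norm_num)]; norm_num)]
        rintro ⟨h1, _⟩
        linarith
      · have h : x = 1 := h
        subst h
        refine ⟨by simp, fun n => ?_⟩
        rw [Function.iterate_fixed (by rw [dbl_hi (by norm_num)]; norm_num)]
        rintro ⟨_, h1⟩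
        linarith

theorem stmt5 (r : ℚ) (hr : 0 < r ∧ r < 1) (a : ℝ) (ha : a ∈ DeltaI [r]) :
    phi a = piMap (per (omegaPlus r)) ∧ ∀ a' ∈ DeltaI [r], phi a' = phi a := by
  obtain ⟨q, hq⟩ : ∃ q, q = r.den := ⟨_, rfl⟩
  obtain ⟨p, hp⟩ : ∃ p, p = r.num.toNat := ⟨_, rfl⟩
  have hnum : 0 < r.num := Rat.num_pos.2 hr.1
  have hp0 : 0 < p := by omega
  have hpq : p < q := by
    have := Rat.num_lt_denom_iff.2 hr.2
    omega
  have hcop : Nat.Coprime p q := by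
    have := r.reduced
    rw [show r.num.natAbs = p by omega, ← hq] at this
    exact this
  have hm := omegaMinus_eq r _ (isOmegaMinus_mword r p q hq hp hp0 hpq)
  have hpl := omegaPlus_eq r _ (isOmegaPlus_mword r p q hq hp hp0 hpq)
  have hpi : piMap (per (omegaPlus r)) = gfun p q (q - p) := by
    rw [hpl, per_mword _ _ _ (by omega), piMap_mdig _ _ _ (by omega) hpq.le (by omega)]
  have main : ∀ a ∈ DeltaI [r], phi a = piMap (per (omegaPlus r)) := by
    rintro a ⟨h1, h2⟩
    have es : sWord [r] = omegaMinus r := by simp [sWord, substR]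
    have et : tWord [r] = omegaPlus r := by simp [tWord, substR]
    rw [es, hm, per_mword _ _ _ (by omega), piMap_mdig _ _ _ (by omega) hpq.le (by omega)] at h1
    rw [es, et, hm, hpl, cat_val p q hcop hp0 hpq] at h2
    rw [hpi]
    exact phi_val p q hp0 hpq a h2 h1
  exact ⟨main a ha, fun a' ha' => (main a' ha').trans (main a ha).symm⟩

end
end

section
/- If (s,t) and (S,T) are extremal pairs of finite binary words, then the pair (S(s,t), T(s,t)) is extremal, where for a binary word W, W(s,t) denotes the word obtained from W by replacing each letter 0 by the word s and each letter 1 by the word t. -/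
noncomputable section

/-- A pair `(s,t)` of finite binary words (s beginning with 0, t with 1) is extremal. -/
def Extremal (s t : List Bool) : Prop :=
  s.head? = some false ∧ t.head? = some true ∧
  (∀ k, 1 ≤ k → k ≤ s.length - 1 →
    ¬ (seqLe (per s) (shft^[k] (per s)) ∧ seqLt (shft^[k] (per s)) (per t))) ∧
  (∀ l, 1 ≤ l → l ≤ t.length - 1 →
    ¬ (seqLt (per s) (shft^[l] (per t)) ∧ seqLe (shft^[l] (per t)) (per t)))

/-- Substitute `s` for each 0 and `t` for each 1 in the word `W`. -/
def substW (s t W : List Bool) : List Bool :=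
  (W.map (fun b => if b then t else s)).flatten

/-! ### Helper lemmas -/

lemma seqLt_iff (u v : ℕ → Bool) : seqLt u v ↔ toLex u < toLex v := Iff.rfl

lemma seqLe_iff (u v : ℕ → Bool) : seqLe u v ↔ toLex u ≤ toLex v := by
  rw [le_iff_lt_or_eq]; exact Iff.rfl

lemma shft_iter (k : ℕ) (x : ℕ → Bool) : shft^[k] x = fun n => x (n + k) := by
  induction k generalizing x with
  | zero => rfl
  | succ k ih =>
    rw [Function.iterate_succ_apply, ih]
    funext n
    simp only [shft]
    congr 1

lemma cat_lt (w : List Bool) (x y : ℕ → Bool) :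
    toLex (cat w x) < toLex (cat w y) ↔ toLex x < toLex y := by
  rw [← seqLt_iff, ← seqLt_iff]
  constructor
  · rintro ⟨n, h, hn⟩
    by_cases hw : n < w.length
    · simp [cat, hw] at hn
    · refine ⟨n - w.length, fun i hi => ?_, by simpa [cat, hw] using hn⟩
      have := h (i + w.length) (by omega)
      simpa [cat] using this
  · rintro ⟨n, h, hn⟩
    refine ⟨n + w.length, fun i hi => ?_, by simpa [cat] using hn⟩
    by_cases hw : i < w.length
    · simp [cat, hw]
    · simp only [cat, hw, if_false]
      exact h _ (by omega)

lemma cat_le (w : List Bool) (x y : ℕ → Bool) :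
    toLex (cat w x) ≤ toLex (cat w y) ↔ toLex x ≤ toLex y :=
  not_lt.symm.trans ((not_congr (cat_lt w y x)).trans not_lt)

lemma cat_append (u v : List Bool) (x : ℕ → Bool) : cat (u ++ v) x = cat u (cat v x) := by
  funext n
  simp only [cat, List.length_append]
  by_cases h1 : n < u.length
  · have : n < u.length + v.length := by omega
    simp [h1, this, List.getD_append _ _ _ _ h1]
  · by_cases h2 : n < u.length + v.length
    · have h3 : n - u.length < v.length := by omega
      simp only [h1, h2, h3, if_true, if_false]
      exact List.getD_append_right _ _ _ _ (by omega)
    · have h3 : ¬ n - u.length < v.length := by omega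
      simp only [h1, h2, h3, if_false]
      congr 1
      omega

lemma cat_nil (x : ℕ → Bool) : cat [] x = x := by
  funext n; simp [cat]

lemma per_eq (w : List Bool) (hw : w ≠ []) : per w = cat w (per w) := by
  funext n
  have : 0 < w.length := List.length_pos_of_ne_nil hw
  simp only [cat, per]
  split_ifs with h
  · rw [Nat.mod_eq_of_lt h]
  · rw [← Nat.mod_eq_sub_mod (by omega)]

lemma per_unique (w : List Bool) (hw : w ≠ []) (x : ℕ → Bool) (hx : x = cat w x) : x = per w := by
  have h0 : 0 < w.length := List.length_pos_of_ne_nil hw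
  funext n
  induction n using Nat.strong_induction_on with
  | _ n ih =>
    rw [hx, per_eq w hw]
    simp only [cat]
    split_ifs with h
    · rfl
    · exact ih _ (by omega)

lemma shft_cat (u : List Bool) (x : ℕ → Bool) : shft^[u.length] (cat u x) = x := by
  rw [shft_iter]; funext n; simp [cat]

lemma shft_cat_drop (w : List Bool) (x : ℕ → Bool) (i : ℕ) (hi : i ≤ w.length) :
    shft^[i] (cat w x) = cat (w.drop i) x := by
  conv_lhs => rw [← List.take_append_drop i w, cat_append]
  have h : (w.take i).length = i := by simp [hi]
  have := shft_cat (w.take i) (cat (w.drop i) x)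
  rwa [h] at this

lemma sandwich (v : List Bool) (a b x : ℕ → Bool) (h1 : toLex (cat v a) < toLex x)
    (h2 : toLex x < toLex (cat v b)) : x = cat v (shft^[v.length] x) := by
  rw [← seqLt_iff] at h1 h2
  obtain ⟨n, hn, hn'⟩ := h1
  obtain ⟨m, hm, hm'⟩ := h2
  have key : ∀ i < v.length, x i = v.getD i false := by
    intro i hi
    by_cases hin : i < n
    · have := hn i hin
      simp only [cat, hi, if_true] at this
      exact this.symm
    by_cases him : i < m
    · have := hm i him
      simp only [cat, hi, if_true] at this
      exact this
    exfalso
    have hnl : n < v.length := by omega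
    have hml : m < v.length := by omega
    simp only [cat, hnl, hml, if_true] at hn' hm'
    rcases lt_trichotomy n m with h | h | h
    · have := hm n h
      simp only [cat, hnl, if_true] at this
      rw [this] at hn'
      exact lt_irrefl _ hn'
    · subst h
      exact lt_irrefl _ (hn'.trans hm')
    · have := hn m h
      simp only [cat, hml, if_true] at this
      rw [this] at hm'
      exact lt_irrefl _ hm'
  funext i
  simp only [cat, shft_iter]
  split_ifs with h
  · exact key i h
  · congr 1; omega

/-- The block substituted for a letter. -/
def blk (s t : List Bool) (b : Bool) : List Bool := if b then t else s

/-- The substitution on infinite sequences. -/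
def subS (s t : List Bool) (y : ℕ → Bool) (n : ℕ) : Bool :=
  if n < (blk s t (y 0)).length then (blk s t (y 0)).getD n false
  else if (blk s t (y 0)).length = 0 then false
  else subS s t (shft y) (n - (blk s t (y 0)).length)
termination_by n
decreasing_by omega

lemma blk_ne {s t : List Bool} (hs : s ≠ []) (ht : t ≠ []) (b : Bool) : blk s t b ≠ [] := by
  cases b <;> simpa [blk]

lemma subS_eq {s t : List Bool} (hs : s ≠ []) (ht : t ≠ []) (y : ℕ → Bool) :
    subS s t y = cat (blk s t (y 0)) (subS s t (shft y)) := by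
  funext n
  have := List.length_pos_of_ne_nil (blk_ne hs ht (y 0))
  rw [subS, cat, if_neg (by omega : ¬ (blk s t (y 0)).length = 0)]

lemma substW_cons (s t : List Bool) (b : Bool) (W : List Bool) :
    substW s t (b :: W) = blk s t b ++ substW s t W := by
  simp [substW, blk]

lemma substW_append (s t : List Bool) (U W : List Bool) :
    substW s t (U ++ W) = substW s t U ++ substW s t W := by
  simp [substW]

lemma shft_cat_cons (b : Bool) (W : List Bool) (x : ℕ → Bool) :
    shft (cat (b :: W) x) = cat W x := by
  have := shft_cat_drop (b :: W) x 1 (by simp)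
  simpa using this

lemma subS_cat {s t : List Bool} (hs : s ≠ []) (ht : t ≠ []) (W : List Bool) (x : ℕ → Bool) :
    subS s t (cat W x) = cat (substW s t W) (subS s t x) := by
  induction W with
  | nil => simp [substW, cat_nil]
  | cons b W ih =>
    rw [subS_eq hs ht, shft_cat_cons, ih, substW_cons, cat_append]
    rfl

lemma substW_ne {s t : List Bool} (hs : s ≠ []) (ht : t ≠ []) (W : List Bool) (hW : W ≠ []) :
    substW s t W ≠ [] := by
  cases W with
  | nil => exact absurd rfl hW
  | cons b W => rw [substW_cons]; simp [blk_ne hs ht b]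

lemma per_substW {s t : List Bool} (hs : s ≠ []) (ht : t ≠ []) (W : List Bool) (hW : W ≠ []) :
    per (substW s t W) = subS s t (per W) := by
  symm
  apply per_unique _ (substW_ne hs ht W hW)
  rw [← subS_cat hs ht, ← per_eq W hW]

lemma subS_lt {s t : List Bool} (hs : s.head? = some false) (ht : t.head? = some true)
    (x y : ℕ → Bool) (h : toLex x < toLex y) : toLex (subS s t x) < toLex (subS s t y) := by
  have hs' : s ≠ [] := by rintro rfl; simp at hs
  have ht' : t ≠ [] := by rintro rfl; simp at ht
  rw [← seqLt_iff] at h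
  obtain ⟨n, h, hn⟩ := h
  induction n generalizing x y with
  | zero =>
    have hx : x 0 = false ∧ y 0 = true := by
      revert hn; cases x 0 <;> cases y 0 <;> simp
    rw [subS_eq hs' ht' x, subS_eq hs' ht' y, hx.1, hx.2, ← seqLt_iff]
    refine ⟨0, by simp, ?_⟩
    obtain ⟨a, s, rfl⟩ := List.exists_cons_of_ne_nil hs'
    obtain ⟨b, t, rfl⟩ := List.exists_cons_of_ne_nil ht'
    simp at hs ht
    simp [cat, blk, hs, ht]
  | succ n ih =>
    rw [subS_eq hs' ht' x, subS_eq hs' ht' y, h 0 (by omega), cat_lt]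
    exact ih _ _ (fun i hi => h (i + 1) (by omega)) hn

lemma subS_strictMono {s t : List Bool} (hs : s.head? = some false) (ht : t.head? = some true) :
    StrictMono (fun x : Lex (ℕ → Bool) => toLex (subS s t (ofLex x))) :=
  fun x y h => subS_lt hs ht (ofLex x) (ofLex y) h

lemma subS_lt_iff {s t : List Bool} (hs : s.head? = some false) (ht : t.head? = some true)
    (x y : ℕ → Bool) : toLex (subS s t x) < toLex (subS s t y) ↔ toLex x < toLex y :=
  (subS_strictMono hs ht).lt_iff_lt (a := toLex x) (b := toLex y)

lemma subS_le_iff {s t : List Bool} (hs : s.head? = some false) (ht : t.head? = some true)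
    (x y : ℕ → Bool) : toLex (subS s t x) ≤ toLex (subS s t y) ↔ toLex x ≤ toLex y :=
  (subS_strictMono hs ht).le_iff_le (a := toLex x) (b := toLex y)

lemma per_singleton (b : Bool) (n : ℕ) : per [b] n = b := by
  simp [per, Nat.mod_one]

lemma per_false_le (y : ℕ → Bool) : toLex (per [false]) ≤ toLex y := by
  apply Pi.toLex_monotone
  intro n
  rw [per_singleton]; exact Bool.false_le _

lemma le_per_true (y : ℕ → Bool) : toLex y ≤ toLex (per [true]) := by
  apply Pi.toLex_monotone
  intro n
  rw [per_singleton]; exact Bool.le_true _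

/-- Proper suffixes avoid the gap. -/
lemma suffix_gap {s t : List Bool} (h : Extremal s t) (b : Bool) (i : ℕ) (hi : 1 ≤ i)
    (hi' : i < (blk s t b).length) :
    toLex (cat ((blk s t b).drop i) (per t)) ≤ toLex (per s) ∨
    toLex (per t) ≤ toLex (cat ((blk s t b).drop i) (per s)) := by
  obtain ⟨hs, ht, h1, h2⟩ := h
  have hs' : s ≠ [] := by rintro rfl; simp at hs
  have ht' : t ≠ [] := by rintro rfl; simp at ht
  simp only [seqLe_iff, seqLt_iff] at h1 h2
  cases b with
  | false =>
    simp only [blk, Bool.false_eq_true, if_false] at hi' ⊢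
    have e : shft^[i] (per s) = cat (s.drop i) (per s) := by
      conv_lhs => rw [per_eq s hs']
      exact shft_cat_drop _ _ _ hi'.le
    by_contra! hc
    obtain ⟨hc1, hc2⟩ := hc
    have h3 := h1 i hi (by omega)
    rw [e] at h3
    have h4 : toLex (cat (s.drop i) (per s)) < toLex (per s) := by
      by_contra h4
      exact h3 ⟨not_lt.1 h4, hc2⟩
    have h5 := sandwich _ _ _ _ h4 hc1
    rw [h5] at hc1
    replace hc1 := (cat_lt _ _ _).1 hc1
    rw [show toLex (per s) = toLex (cat (s.drop i) (shft^[(s.drop i).length] (per s))) from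
      congrArg _ h5, cat_lt] at h4
    exact h1 (s.drop i).length (by simp; omega) (by simp; omega) ⟨h4.le, hc1⟩
  | true =>
    simp only [blk, if_true] at hi' ⊢
    have e : shft^[i] (per t) = cat (t.drop i) (per t) := by
      conv_lhs => rw [per_eq t ht']
      exact shft_cat_drop _ _ _ hi'.le
    by_contra! hc
    obtain ⟨hc1, hc2⟩ := hc
    have h3 := h2 i hi (by omega)
    rw [e] at h3
    have h4 : toLex (per t) < toLex (cat (t.drop i) (per t)) := by
      by_contra h4
      exact h3 ⟨hc1, not_lt.1 h4⟩
    have h5 := sandwich _ _ _ _ hc2 h4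
    rw [h5] at hc2
    replace hc2 := (cat_lt _ _ _).1 hc2
    rw [show toLex (per t) = toLex (cat (t.drop i) (shft^[(t.drop i).length] (per t))) from
      congrArg _ h5, cat_lt] at h4
    exact h2 (t.drop i).length (by simp; omega) (by simp; omega) ⟨hc2, h4.le⟩

lemma substW_split {s t : List Bool} (W : List Bool) (k : ℕ)
    (hk : k < (substW s t W).length) :
    ∃ U b V i, W = U ++ b :: V ∧ i < (blk s t b).length ∧ k = (substW s t U).length + i := by
  induction W generalizing k with
  | nil => simp [substW] at hk
  | cons b W ih =>
    rw [substW_cons, List.length_append] at hk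
    by_cases h : k < (blk s t b).length
    · exact ⟨[], b, W, k, rfl, h, by simp [substW]⟩
    · obtain ⟨U, c, V, i, rfl, hi, hk'⟩ := ih (k - (blk s t b).length) (by omega)
      refine ⟨b :: U, c, V, i, rfl, hi, ?_⟩
      rw [substW_cons, List.length_append]
      omega

/-- Shifts of a substituted periodic word. -/
lemma shift_cases {s t : List Bool} (hs : s ≠ []) (ht : t ≠ []) (W : List Bool) (hW : W ≠ [])
    (k : ℕ) (hk : 1 ≤ k) (hk' : k ≤ (substW s t W).length - 1) :
    (∃ j, 1 ≤ j ∧ j ≤ W.length - 1 ∧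
      shft^[k] (per (substW s t W)) = subS s t (shft^[j] (per W))) ∨
    (∃ b i j, 1 ≤ i ∧ i < (blk s t b).length ∧
      shft^[k] (per (substW s t W)) =
        cat ((blk s t b).drop i) (subS s t (shft^[j] (per W)))) := by
  obtain ⟨U, b, V, i, hU, hi, rfl⟩ := substW_split (s := s) (t := t) W k (by omega)
  have e1 : per W = cat U (cat [b] (cat V (per W))) := by
    rw [← cat_append, ← cat_append]
    rw [show U ++ [b] ++ V = W by rw [hU]; simp]
    exact per_eq W hW
  have e2 : shft^[U.length] (per W) = cat [b] (cat V (per W)) := by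
    conv_lhs => rw [e1]
    exact shft_cat _ _
  have e3 : shft^[U.length + 1] (per W) = cat V (per W) := by
    rw [Function.iterate_succ_apply', e2, shft_cat_cons, cat_nil]
  have e4 : shft^[(substW s t U).length] (per (substW s t W)) =
      subS s t (shft^[U.length] (per W)) := by
    rw [per_substW hs ht W hW, e2]
    conv_lhs => rw [e1]
    rw [subS_cat hs ht U, shft_cat]
  have e5 : shft^[(substW s t U).length + i] (per (substW s t W)) =
      cat ((blk s t b).drop i) (subS s t (shft^[U.length + 1] (per W))) := by
    rw [add_comm, Function.iterate_add_apply, e4, e3, e2, subS_cat hs ht [b]]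
    rw [show substW s t [b] = blk s t b by simp [substW, blk]]
    exact shft_cat_drop _ _ _ hi.le
  rcases Nat.eq_zero_or_pos i with rfl | hi0
  · left
    refine ⟨U.length, ?_, ?_, e4⟩
    · rcases U with _ | ⟨c, U⟩
      · simp [substW] at hk
      · simp
    · rw [hU]; simp
  · right
    exact ⟨b, i, U.length + 1, hi0, hi, e5⟩

lemma shift_per_head (W : List Bool) (c : Bool) (hW : W.head? = some c) (j : ℕ) :
    ∃ n, shft^[j] (per W) n = c := by
  rcases W with _ | ⟨a, W⟩
  · simp at hW
  · simp at hW
    subst hW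
    refine ⟨(a :: W).length * j - j, ?_⟩
    rw [shft_iter]
    have h : j ≤ (a :: W).length * j := Nat.le_mul_of_pos_left _ (by simp)
    simp only [per]
    rw [Nat.sub_add_cancel h, Nat.mul_mod_right]
    rfl

lemma head_substW {s t W : List Bool} (c : Bool) (hW : W.head? = some c)
    (hc : (blk s t c).head? = some c) : (substW s t W).head? = some c := by
  rcases W with _ | ⟨a, W⟩
  · simp at hW
  · simp at hW
    subst hW
    rw [substW_cons, List.head?_append, hc]; rfl

theorem stmt6 (s t S T : List Bool) (hst : Extremal s t) (hST : Extremal S T) :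
    Extremal (substW s t S) (substW s t T) := by
  have gap := fun b i => suffix_gap hst b i
  obtain ⟨hs, ht, -, -⟩ := hst
  obtain ⟨hS, hT, H1, H2⟩ := hST
  have hs' : s ≠ [] := by rintro rfl; simp at hs
  have ht' : t ≠ [] := by rintro rfl; simp at ht
  have hS' : S ≠ [] := by rintro rfl; simp at hS
  have hT' : T ≠ [] := by rintro rfl; simp at hT
  have es : per s = subS s t (per [false]) := by
    rw [← per_substW hs' ht' _ (by simp)]; simp [substW]
  have et : per t = subS s t (per [true]) := by
    rw [← per_substW hs' ht' _ (by simp)]; simp [substW]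
  have low : ∀ y, toLex (per s) ≤ toLex (subS s t y) := by
    intro y; rw [es, subS_le_iff hs ht]; exact per_false_le y
  have high : ∀ y, toLex (subS s t y) ≤ toLex (per t) := by
    intro y; rw [et, subS_le_iff hs ht]; exact le_per_true y
  refine ⟨head_substW _ hS (by simpa [blk] using hs), head_substW _ hT (by simpa [blk] using ht),
    ?_, ?_⟩
  · intro k hk hk'
    simp only [seqLe_iff, seqLt_iff] at H1 ⊢
    rcases shift_cases hs' ht' S hS' k hk hk' with ⟨j, hj, hj', e⟩ | ⟨b, i, j, hi, hi', e⟩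
    · rw [e, per_substW hs' ht' S hS', per_substW hs' ht' T hT', subS_le_iff hs ht,
        subS_lt_iff hs ht]
      exact H1 j hj hj'
    · rw [e, per_substW hs' ht' S hS', per_substW hs' ht' T hT']
      rintro ⟨hA, hB⟩
      rcases gap b i hi hi' with hg | hg
      · have hlt : toLex (subS s t (shft^[j] (per S))) < toLex (per t) := by
          rw [et, subS_lt_iff hs ht]
          refine lt_of_le_of_ne (le_per_true _) fun hEq => ?_
          obtain ⟨n, hn⟩ := shift_per_head S false hS j
          have := congrFun (toLex.injective hEq) n
          rw [hn, per_singleton] at this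
          simp at this
        have h3 := (cat_lt ((blk s t b).drop i) _ _).2 hlt
        exact absurd (hA.trans_lt (h3.trans_le hg)) (not_lt.2 (low _))
      · have h3 := (cat_le ((blk s t b).drop i) _ _).2 (low (shft^[j] (per S)))
        exact absurd (((high _).trans hg).trans h3) (not_le.2 hB)
  · intro k hk hk'
    simp only [seqLe_iff, seqLt_iff] at H2 ⊢
    rcases shift_cases hs' ht' T hT' k hk hk' with ⟨j, hj, hj', e⟩ | ⟨b, i, j, hi, hi', e⟩
    · rw [e, per_substW hs' ht' S hS', per_substW hs' ht' T hT', subS_le_iff hs ht,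
        subS_lt_iff hs ht]
      exact H2 j hj hj'
    · rw [e, per_substW hs' ht' S hS', per_substW hs' ht' T hT']
      rintro ⟨hA, hB⟩
      rcases gap b i hi hi' with hg | hg
      · have h3 := (cat_le ((blk s t b).drop i) _ _).2 (high (shft^[j] (per T)))
        exact absurd ((h3.trans hg).trans (low _)) (not_le.2 hA)
      · have hlt : toLex (per s) < toLex (subS s t (shft^[j] (per T))) := by
          rw [es, subS_lt_iff hs ht]
          refine lt_of_le_of_ne (per_false_le _) fun hEq => ?_
          obtain ⟨n, hn⟩ := shift_per_head T true hT j
          have := congrFun (toLex.injective hEq) n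
          rw [hn, per_singleton] at this
          simp at this
        have h3 := (cat_lt ((blk s t b).drop i) _ _).2 hlt
        exact absurd ((hg.trans_lt h3).trans_le hB) (not_lt.2 (high _))

end
end

section
/- For every n ≥ 2 and all rationals r_1,…,r_{n−1} ∈ (0,1), dim_H 𝒮_n(r_1,…,r_{n−1}) = 0; consequently, the set 𝕊 has zero Hausdorff dimension. -/
noncomputable section

/-- `𝒮_n(r_1,…,r_{n-1})`, where `rs = (r_1,…,r_{n-1})`. -/
def Sn (rs : List ℚ) : Set ℝ :=
  DeltaTilde rs \ ⋃ r ∈ {r : ℚ | 0 < r ∧ r < 1}, DeltaI (rs ++ [r])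

/-- `𝕊 = 𝒮 ∪ ⋃_{n≥2} ⋃_{r_1,…,r_{n-1}} 𝒮_n(r_1,…,r_{n-1})`. -/
def bigS : Set ℝ :=
  Scal ∪ ⋃ rs ∈ {l : List ℚ | 1 ≤ l.length ∧ ∀ r ∈ l, 0 < r ∧ r < 1}, Sn rs

theorem dimH_zero_of_cover (A : Set ℝ) (C γ : ℝ) (hC : 0 ≤ C) (hγ : 0 < γ) (hγ1 : γ < 1)
    (h : ∀ N : ℕ, ∃ f : Fin (N+2) × Fin (N+2) → ℝ, A ⊆ ⋃ i, Set.Icc (f i) (f i + C*γ^N)) :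
    dimH A = 0 := by
  rw [← nonpos_iff_eq_zero]
  refine dimH_le fun d hd => ?_
  by_contra hd0
  have hdpos : 0 < d := by
    rcases eq_or_ne d 0 with h0 | h0
    · simp [h0] at hd0
    · exact pos_iff_ne_zero.2 h0
  have hdpos' : (0:ℝ) < d := by exact_mod_cast hdpos
  choose f hf using h
  have hlim : Filter.Tendsto (fun N : ℕ => C * γ^N) Filter.atTop (nhds 0) := by
    simpa using (tendsto_pow_atTop_nhds_zero_of_lt_one hγ.le hγ1).const_mul C
  have key := MeasureTheory.Measure.hausdorffMeasure_le_liminf_sum (d : ℝ) A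
    (l := Filter.atTop) (fun N : ℕ => ENNReal.ofReal (C * γ^N))
    (by simpa [Function.comp_def] using (ENNReal.continuous_ofReal.tendsto 0).comp hlim)
    (fun N (i : Fin (N+2) × Fin (N+2)) => Set.Icc (f N i) (f N i + C*γ^N))
    (Filter.Eventually.of_forall fun N i => by
      rw [Real.ediam_Icc]; simp)
    (Filter.Eventually.of_forall hf)
  have h2 : Filter.Tendsto (fun N : ℕ => ∑ i : Fin (N+2) × Fin (N+2),
      (Metric.ediam (Set.Icc (f N i) (f N i + C*γ^N))) ^ (d:ℝ)) Filter.atTop (nhds 0) := by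
    have h3 : ∀ N : ℕ, ∑ i : Fin (N+2) × Fin (N+2),
      (Metric.ediam (Set.Icc (f N i) (f N i + C*γ^N))) ^ (d:ℝ)
        = ENNReal.ofReal (((N:ℝ)+2)^2 * (C^(d:ℝ) * (γ^(d:ℝ))^N)) := by
      intro N
      simp only [Real.ediam_Icc, add_sub_cancel_left, Finset.sum_const, Finset.card_univ,
        Fintype.card_prod, Fintype.card_fin, nsmul_eq_mul]
      rw [ENNReal.ofReal_rpow_of_nonneg (by positivity) hdpos'.le,
        ENNReal.ofReal_mul (by positivity)]
      congr 1
      · rw [← ENNReal.ofReal_natCast]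
        congr 1
        push_cast; ring
      · congr 1
        rw [Real.mul_rpow hC (by positivity), ← Real.rpow_natCast, ← Real.rpow_natCast,
          ← Real.rpow_mul hγ.le, ← Real.rpow_mul hγ.le, mul_comm (N:ℝ)]
    simp_rw [h3]
    have hδ0 : 0 ≤ γ^(d:ℝ) := by positivity
    have hδ1 : γ^(d:ℝ) < 1 := Real.rpow_lt_one hγ.le hγ1 hdpos'
    have t0 := tendsto_pow_const_mul_const_pow_of_lt_one 0 hδ0 hδ1
    have t1 := tendsto_pow_const_mul_const_pow_of_lt_one 1 hδ0 hδ1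
    have t2 := tendsto_pow_const_mul_const_pow_of_lt_one 2 hδ0 hδ1
    have t3 : Filter.Tendsto (fun N : ℕ => ((N:ℝ)+2)^2 * (C^(d:ℝ) * (γ^(d:ℝ))^N))
        Filter.atTop (nhds 0) := by
      have := ((t2.add (t1.const_mul 4)).add (t0.const_mul 4)).const_mul (C^(d:ℝ))
      simp only [mul_zero, add_zero] at this
      refine this.congr fun N => ?_
      ring
    simpa [Function.comp_def] using (ENNReal.continuous_ofReal.tendsto 0).comp t3
  rw [h2.liminf_eq, hd] at key
  simp at key

/-- left end point -/
def Lf (β : ℝ) (r : ℚ) : ℝ := (1-β) * ∑' k : ℕ, (⌈((k:ℚ)+1) * r⌉ : ℝ) * β^(k+2)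

/-- right end point -/
def Rf (β : ℝ) (r : ℚ) : ℝ := (1-β) * ∑' k : ℕ, ((⌊((k:ℚ)+1) * r⌋ : ℝ) + 1) * β^(k+2)

theorem lin_pow_bound (k : ℕ) : ((k:ℝ)+1) * (1/2)^(k+2) ≤ (3/4)^k := by
  have h := one_add_mul_le_pow (a := (1/2:ℝ)) (by norm_num) k
  have h2 : (3/4:ℝ)^k = (1+1/2)^k * (1/2)^k := by rw [← mul_pow]; norm_num
  have h3 : (0:ℝ) ≤ (1/2)^k := by positivity
  have h4 := mul_le_mul_of_nonneg_right h h3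
  have h5 : (0:ℝ) ≤ k * (1/2)^k := by positivity
  rw [h2, pow_add]
  nlinarith

theorem coef_summable {β : ℝ} (hβ : 0 < β) (hβ2 : β ≤ 1/2) (c : ℕ → ℝ)
    (h0 : ∀ k, 0 ≤ c k) (h1 : ∀ k, c k ≤ (k:ℝ) + 2) :
    Summable (fun k : ℕ => c k * β^(k+2)) := by
  have hg : Summable (fun k : ℕ => 2 * (3/4:ℝ)^k) :=
    (summable_geometric_of_lt_one (by norm_num) (by norm_num)).mul_left 2
  refine Summable.of_nonneg_of_le (fun k => by have := h0 k; positivity) (fun k => ?_) hg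
  have hb : β^(k+2) ≤ (1/2)^(k+2) := pow_le_pow_left₀ hβ.le hβ2 _
  have := lin_pow_bound k
  calc c k * β^(k+2) ≤ (2*((k:ℝ)+1)) * (1/2)^(k+2) := by
        apply mul_le_mul _ hb (by positivity) (by positivity)
        have := h1 k
        have : (0:ℝ) ≤ k := by positivity
        linarith
    _ ≤ _ := by linarith

theorem Lf_coef {r : ℚ} (h0 : 0 ≤ r) (h1 : r ≤ 1) (k : ℕ) :
    (0:ℝ) ≤ (⌈((k:ℚ)+1) * r⌉ : ℝ) ∧ (⌈((k:ℚ)+1) * r⌉ : ℝ) ≤ k + 1 := by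
  constructor
  · exact_mod_cast Int.ceil_nonneg (by positivity)
  · have : ⌈((k:ℚ)+1) * r⌉ ≤ (k:ℤ) + 1 := by
      rw [Int.ceil_le]; push_cast
      have : (0:ℚ) ≤ k := by positivity
      nlinarith
    exact_mod_cast this

theorem Rf_coef {r : ℚ} (h0 : 0 ≤ r) (h1 : r ≤ 1) (k : ℕ) :
    (0:ℝ) ≤ (⌊((k:ℚ)+1) * r⌋ : ℝ) ∧ (⌊((k:ℚ)+1) * r⌋ : ℝ) ≤ k + 1 := by
  constructor
  · exact_mod_cast Int.floor_nonneg.2 (by positivity)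
  · refine le_trans ?_ (Lf_coef h0 h1 k).2
    exact_mod_cast Int.floor_le_ceil _

theorem gap_bound {β : ℝ} (hβ : 0 < β) (hβ2 : β ≤ 1/2) {r r' : ℚ} (h0 : 0 ≤ r) (h1 : r ≤ 1)
    (h0' : 0 ≤ r') (h1' : r' ≤ 1) (N : ℕ)
    (h : ∀ k : ℕ, k ≤ N → ⌈((k:ℚ)+1) * r'⌉ ≤ ⌊((k:ℚ)+1) * r⌋ + 1) :
    Lf β r' ≤ Rf β r + 10 * (9/10)^N := by
  have s1 : Summable (fun k : ℕ => (⌈((k:ℚ)+1) * r'⌉ : ℝ) * β^(k+2)) :=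
    coef_summable hβ hβ2 _ (fun k => (Lf_coef h0' h1' k).1)
      (fun k => by linarith [(Lf_coef h0' h1' k).2])
  have s2 : Summable (fun k : ℕ => ((⌊((k:ℚ)+1) * r⌋ : ℝ) + 1) * β^(k+2)) :=
    coef_summable hβ hβ2 _ (fun k => by linarith [(Rf_coef h0 h1 k).1])
      (fun k => by linarith [(Rf_coef h0 h1 k).2])
  have hg : HasSum (fun k : ℕ => (9/10:ℝ)^N * (9/10:ℝ)^k) ((9/10:ℝ)^N * 10) := by
    have := (hasSum_geometric_of_lt_one (r := (9/10:ℝ)) (by norm_num) (by norm_num)).mul_left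
      ((9/10:ℝ)^N)
    norm_num at this ⊢
    exact this
  have key : ∑' k : ℕ, (⌈((k:ℚ)+1) * r'⌉ : ℝ) * β^(k+2)
      - ∑' k : ℕ, ((⌊((k:ℚ)+1) * r⌋ : ℝ) + 1) * β^(k+2) ≤ (9/10:ℝ)^N * 10 := by
    rw [← s1.tsum_sub s2, ← hg.tsum_eq]
    refine (s1.sub s2).tsum_le_tsum (fun k => ?_) hg.summable
    by_cases hk : k ≤ N
    · have h2 : (⌈((k:ℚ)+1) * r'⌉ : ℝ) ≤ (⌊((k:ℚ)+1) * r⌋ : ℝ) + 1 := by exact_mod_cast h k hk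
      have h3 : (0:ℝ) ≤ β^(k+2) := by positivity
      have h4 : (0:ℝ) ≤ (9/10:ℝ)^N * (9/10:ℝ)^k := by positivity
      nlinarith
    · push Not at hk
      have hb : β^(k+2) ≤ (1/2)^(k+2) := pow_le_pow_left₀ hβ.le hβ2 _
      have h3 : (0:ℝ) ≤ β^(k+2) := by positivity
      have h5 := lin_pow_bound k
      have h6 : (3/4:ℝ)^k ≤ (9/10:ℝ)^k * (9/10:ℝ)^k := by
        rw [← mul_pow]; exact pow_le_pow_left₀ (by norm_num) (by norm_num) _
      have h7 : (9/10:ℝ)^k ≤ (9/10:ℝ)^N :=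
        pow_le_pow_of_le_one (by norm_num) (by norm_num) hk.le
      have h8 : (9/10:ℝ)^k * (9/10:ℝ)^k ≤ (9/10:ℝ)^N * (9/10:ℝ)^k :=
        mul_le_mul_of_nonneg_right h7 (by positivity)
      have h9 := (Lf_coef h0' h1' k).2
      have h10 := (Rf_coef h0 h1 k).1
      have h11 : ((k:ℝ)+1) * β^(k+2) ≤ ((k:ℝ)+1) * (1/2)^(k+2) :=
        mul_le_mul_of_nonneg_left hb (by positivity)
      have h12 : (⌈((k:ℚ)+1) * r'⌉ : ℝ) * β^(k+2) ≤ ((k:ℝ)+1) * β^(k+2) :=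
        mul_le_mul_of_nonneg_right h9 h3
      have h13 : 0 ≤ ((⌊((k:ℚ)+1) * r⌋ : ℝ) + 1) * β^(k+2) := by positivity
      linarith
  unfold Lf Rf
  have hp : (0:ℝ) ≤ (9/10:ℝ)^N * 10 := by positivity
  nlinarith

/-- exceptional set in base `β` -/
def Eset (β : ℝ) : Set ℝ := {y | Rf β 0 ≤ y ∧ y ≤ Lf β 1 ∧
  ∀ r : ℚ, 0 < r → r < 1 → ¬ (Lf β r ≤ y ∧ y ≤ Rf β r)}

theorem Eset_cover {β : ℝ} (hβ : 0 < β) (hβ2 : β ≤ 1/2) {y : ℝ} (hy : y ∈ Eset β) (N : ℕ) :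
    ∃ i : Fin (N+2) × Fin (N+2), Rf β (((i.1:ℕ):ℚ) / ((i.2:ℕ):ℚ)) ≤ y ∧
      y ≤ Rf β (((i.1:ℕ):ℚ) / ((i.2:ℕ):ℚ)) + 10 * (9/10)^N := by
  classical
  obtain ⟨hy0, hy1, hyr⟩ := hy
  set q : Fin (N+2) × Fin (N+2) → ℚ := fun i => ((i.1:ℕ):ℚ) / ((i.2:ℕ):ℚ) with hq
  set F : Finset ℚ := Finset.univ.image q with hF
  have hmem : ∀ a m : ℕ, a < N+2 → m < N+2 → (a:ℚ)/(m:ℚ) ∈ F := by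
    intro a m ha hm
    exact Finset.mem_image.2 ⟨(⟨a, ha⟩, ⟨m, hm⟩), Finset.mem_univ _, rfl⟩
  have hnn : ∀ r ∈ F, 0 ≤ r := by
    intro r hr
    obtain ⟨i, -, rfl⟩ := Finset.mem_image.1 hr
    simp only [hq]; positivity
  set S := F.filter (fun r => r < 1 ∧ Rf β r ≤ y) with hS
  have hSne : S.Nonempty := ⟨0, by
    rw [hS, Finset.mem_filter]
    exact ⟨by simpa using hmem 0 0 (by omega) (by omega), by norm_num, hy0⟩⟩
  obtain ⟨r, hrS, hrmax⟩ : ∃ r ∈ S, ∀ x ∈ S, x ≤ r := ⟨S.max' hSne, S.max'_mem _, S.le_max'⟩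
  rw [hS, Finset.mem_filter] at hrS
  obtain ⟨hrF, hr1, hrR⟩ := hrS
  set T := F.filter (fun x => r < x ∧ x ≤ 1) with hT
  have hTne : T.Nonempty := ⟨1, by
    rw [hT, Finset.mem_filter]
    exact ⟨by simpa using hmem 1 1 (by omega) (by omega), hr1, le_rfl⟩⟩
  obtain ⟨r', hrT, hrmin⟩ : ∃ r ∈ T, ∀ x ∈ T, r ≤ x := ⟨T.min' hTne, T.min'_mem _, T.min'_le⟩
  rw [hT, Finset.mem_filter] at hrT
  obtain ⟨hrF', hrr, hr1'⟩ := hrT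
  have hyL : y ≤ Lf β r' := by
    rcases hr1'.lt_or_eq with h | h
    · have h2 : ¬ Rf β r' ≤ y := by
        intro h3
        have := hrmax r' (by rw [hS, Finset.mem_filter]; exact ⟨hrF', h, h3⟩)
        linarith
      by_contra h4
      push Not at h2 h4
      exact hyr r' (lt_of_le_of_lt (hnn r hrF) hrr) h ⟨h4.le, h2.le⟩
    · rw [h]; exact hy1
  have hgap := gap_bound hβ hβ2 (hnn r hrF) hr1.le (hnn r' hrF') hr1' N (by
    intro k hk
    by_contra hc
    push Not at hc
    have hk0 : (0:ℚ) < (k:ℚ)+1 := by positivity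
    have a1 : ((k:ℚ)+1) * r < (⌊((k:ℚ)+1) * r⌋ : ℚ) + 1 := Int.lt_floor_add_one _
    have a2 : (((⌊((k:ℚ)+1) * r⌋ + 1 : ℤ)) : ℚ) < ((k:ℚ)+1) * r' := Int.lt_ceil.1 hc
    have a3 : 0 ≤ ⌊((k:ℚ)+1) * r⌋ := Int.floor_nonneg.2 (mul_nonneg hk0.le (hnn r hrF))
    obtain ⟨j, hj⟩ := Int.eq_ofNat_of_zero_le (show 0 ≤ ⌊((k:ℚ)+1) * r⌋ + 1 by omega)
    have hj' : (⌊((k:ℚ)+1) * r⌋ : ℚ) + 1 = (j:ℚ) := by exact_mod_cast hj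
    push_cast at a2
    rw [hj'] at a1 a2
    have hjk : j < N+2 := by
      have : (j:ℚ) < (k:ℚ)+1 := by nlinarith
      have : j < k+1 := by exact_mod_cast this
      omega
    have hm := hmem j (k+1) hjk (by omega)
    have b1 : r < (j:ℚ)/((k+1:ℕ):ℚ) := by
      rw [lt_div_iff₀ (by positivity)]; push_cast; linarith
    have b2 : (j:ℚ)/((k+1:ℕ):ℚ) < r' := by
      rw [div_lt_iff₀ (by positivity)]; push_cast; linarith
    have := hrmin _ (by rw [hT, Finset.mem_filter]; exact ⟨hm, b1, by linarith⟩)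
    linarith)
  obtain ⟨i, -, hi⟩ := Finset.mem_image.1 hrF
  refine ⟨i, ?_⟩
  change Rf β (q i) ≤ y ∧ y ≤ Rf β (q i) + 10 * (9/10)^N
  rw [hi]
  exact ⟨hrR, hyL.trans hgap⟩

theorem dimH_Eset {β : ℝ} (hβ : 0 < β) (hβ2 : β ≤ 1/2) : dimH (Eset β) = 0 := by
  refine dimH_zero_of_cover _ 10 (9/10) (by norm_num) (by norm_num) (by norm_num) fun N => ?_
  refine ⟨fun i => Rf β (((i.1:ℕ):ℚ) / ((i.2:ℕ):ℚ)), fun y hy => ?_⟩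
  obtain ⟨i, hi⟩ := Eset_cover hβ hβ2 hy N
  exact Set.mem_iUnion.2 ⟨i, hi⟩

/-- factor of an infinite sequence -/
def Wd (x : ℕ → Bool) (a m : ℕ) : List Bool := (List.range m).map (fun i => x (a+i))

/-- number of ones in a prefix -/
def cnt (x : ℕ → Bool) (n : ℕ) : ℤ := ∑ i ∈ Finset.range n, if x i then 1 else 0

theorem Wd_length (x : ℕ → Bool) (a m : ℕ) : (Wd x a m).length = m := by simp [Wd]

theorem Wd_succ (x : ℕ → Bool) (a m : ℕ) : Wd x a (m+1) = Wd x a m ++ [x (a+m)] := by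
  simp [Wd, List.range_succ]

theorem Wd_count (x : ℕ → Bool) (a m : ℕ) :
    ((Wd x a m).count true : ℤ) = cnt x (a+m) - cnt x a := by
  induction m with
  | zero => simp [Wd]
  | succ m ih =>
    rw [Wd_succ, List.count_append, ← add_assoc]
    push_cast
    rw [ih]
    have : cnt x (a+m+1) = cnt x (a+m) + if x (a+m) then 1 else 0 := by
      unfold cnt; rw [Finset.sum_range_succ]
    rw [this]
    cases x (a+m) <;> simp <;> ring

theorem Wd_take (x : ℕ → Bool) (a : ℕ) {n m : ℕ} (h : n ≤ m) :
    (Wd x a m).take n = Wd x a n := by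
  simp [Wd, ← List.map_take, List.take_range, h]

theorem Wd_add (x : ℕ → Bool) (a m n : ℕ) : Wd x a (m+n) = Wd x a m ++ Wd x (a+m) n := by
  simp [Wd, List.range_add, Function.comp_def, add_assoc]

theorem Wd_infix (x : ℕ → Bool) (m : ℕ) (u : List Bool) (h : u <:+: Wd x 0 m) :
    ∃ a, a + u.length ≤ m ∧ u = Wd x a u.length := by
  obtain ⟨s, t, h⟩ := h
  have hl := congrArg List.length h
  simp only [List.length_append, Wd_length] at hl
  refine ⟨s.length, by omega, ?_⟩
  have e : m = s.length + (u.length + t.length) := by omega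
  rw [e, Wd_add, List.append_assoc] at h
  have h2 := (List.append_inj h (by simp [Wd_length])).2
  rw [Wd_add] at h2
  simpa using (List.append_inj h2 (by simp [Wd_length])).1

theorem Wd_infix_of (x : ℕ → Bool) {a k m : ℕ} (h : a + k ≤ m) : Wd x a k <:+: Wd x 0 m := by
  refine ⟨Wd x 0 a, Wd x (a+k) (m-(a+k)), ?_⟩
  have e : m = a + (k + (m-(a+k))) := by omega
  conv_rhs => rw [e, Wd_add, Wd_add]
  simp

theorem Wd_double (x : ℕ → Bool) (q : ℕ) (hx : ∀ n, x (n+q) = x n) :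
    Wd x 0 q ++ Wd x 0 q = Wd x 0 (q+q) := by
  rw [Wd_add]
  congr 1
  simp only [Wd]
  apply List.map_congr_left
  intro i _
  rw [← hx (0+i)]
  congr 1; omega

theorem cycBalanced_iff (x : ℕ → Bool) (q : ℕ) (hx : ∀ n, x (n+q) = x n) :
    CycBalanced (Wd x 0 q) ↔ ∀ a b m, a + m ≤ q + q → b + m ≤ q + q →
      (cnt x (a+m) - cnt x a) - (cnt x (b+m) - cnt x b) ≤ 1 := by
  unfold CycBalanced BalancedWord
  rw [Wd_double x q hx]
  constructor
  · intro h a b m ha hb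
    have := h _ _ (Wd_infix_of x ha) (Wd_infix_of x hb) (by simp [Wd_length])
    rwa [Wd_count, Wd_count] at this
  · intro h u v hu hv hl
    obtain ⟨a, ha, hu⟩ := Wd_infix x _ u hu
    obtain ⟨b, hb, hv⟩ := Wd_infix x _ v hv
    rw [hu, hv, Wd_count, Wd_count, ← hl]
    exact h a b _ ha (by omega)

theorem per_periodic (w : List Bool) (n : ℕ) : per w (n + w.length) = per w n := by
  simp [per]

theorem Wd_per (w : List Bool) : Wd (per w) 0 w.length = w := by
  apply List.ext_getElem
  · simp [Wd_length]
  · intro n h1 h2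
    simp [Wd, per, Nat.mod_eq_of_lt h2, List.getElem?_eq_getElem h2]

theorem per_Wd (x : ℕ → Bool) {q : ℕ} (hq : 0 < q) (hx : ∀ n, x (n+q) = x n) :
    per (Wd x 0 q) = x := by
  funext n
  have hm : n % q < q := Nat.mod_lt _ hq
  have h1 : ∀ k m, x (m + k * q) = x m := by
    intro k
    induction k with
    | zero => simp
    | succ k ih => intro m; rw [Nat.succ_mul, ← add_assoc, hx, ih]
  have h2 : per (Wd x 0 q) n = x (n % q) := by
    simp [per, Wd, List.getD_eq_getElem?_getD, hm]
  rw [h2, ← h1 (n / q) (n % q), mul_comm, Nat.mod_add_div]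

theorem cnt_add (x : ℕ → Bool) (a m : ℕ) :
    cnt x (a + m) = cnt x a + cnt (fun n => x (a + n)) m := by
  unfold cnt; rw [Finset.sum_range_add]

theorem cnt_stair (F : ℕ → ℤ) (h0 : F 0 = 0) (hs : ∀ n, F (n+1) = F n ∨ F (n+1) = F n + 1)
    (n : ℕ) : cnt (fun n => decide (F (n+1) = F n + 1)) n = F n := by
  induction n with
  | zero => simp [cnt, h0]
  | succ n ih =>
    have : ∀ x, cnt x (n+1) = cnt x n + if x n then 1 else 0 := by
      intro x; unfold cnt; rw [Finset.sum_range_succ]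
    rw [this, ih]
    rcases hs n with h | h <;> simp [h]

theorem lex_of_counts_s9 : ∀ (v w : List Bool), v.length = w.length →
    (∀ n, n ≤ v.length → ((v.take n).count true : ℤ) ≤ (w.take n).count true) →
    v = w ∨ List.Lex (· < ·) v w
  | [], [], _, _ => Or.inl rfl
  | [], _ :: _, h, _ => by simp at h
  | _ :: _, [], h, _ => by simp at h
  | a :: v, b :: w, hl, h => by
    have h1 := h 1 (by simp)
    by_cases hab : a = b
    · subst hab
      have ih := lex_of_counts_s9 v w (by simpa using hl) (fun n hn => by
        have := h (n+1) (by simpa using hn)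
        simp only [List.take_succ_cons, List.count_cons] at this
        push_cast at this
        linarith)
      rcases ih with ih | ih
      · left; rw [ih]
      · right; exact List.Lex.cons ih
    · right
      cases a <;> cases b <;> simp at hab h1
      exact List.Lex.rel (by decide)

/-- averaging -/
theorem avg_bounds (F : ℕ → ℤ) (q : ℕ) (p : ℤ) (hp : ∀ n, F (n+q) = F n + p) (m : ℕ) :
    ∑ a ∈ Finset.range q, (F (a+m) - F a) = m * p := by
  induction m with
  | zero => simp
  | succ m ih =>
    have h := Finset.sum_range_sub (fun a => F (a+m)) q
    have h2 : ∑ a ∈ Finset.range q, (F (a+(m+1)) - F a)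
        = ∑ a ∈ Finset.range q, (F (a+m) - F a)
          + ∑ a ∈ Finset.range q, (F (a+1+m) - F (a+m)) := by
      rw [← Finset.sum_add_distrib]
      refine Finset.sum_congr rfl fun a _ => ?_
      rw [show a + (m+1) = a+1+m by ring]; ring
    rw [h2, ih, h, zero_add, add_comm q m, hp]
    push_cast; ring

theorem bal_upper (F : ℕ → ℤ) (q : ℕ) (p : ℤ) (hp : ∀ n, F (n+q) = F n + p) (m a : ℕ) (ha : a < q)
    (hb : ∀ b < q, (F (a+m) - F a) - (F (b+m) - F b) ≤ 1) (c : ℤ) (hc : m * p ≤ q * c) :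
    F (a+m) - F a ≤ c := by
  by_contra h
  push Not at h
  have h1 := avg_bounds F q p hp m
  have h2 : ∑ b ∈ Finset.range q, c < ∑ b ∈ Finset.range q, (F (b+m) - F b) := by
    refine Finset.sum_lt_sum (fun b hb' => ?_) ⟨a, Finset.mem_range.2 ha, h⟩
    have := hb b (Finset.mem_range.1 hb')
    linarith
  simp at h2 h1
  linarith

theorem bal_lower (F : ℕ → ℤ) (q : ℕ) (p : ℤ) (hp : ∀ n, F (n+q) = F n + p) (m a : ℕ) (ha : a < q)
    (hb : ∀ b < q, (F (b+m) - F b) - (F (a+m) - F a) ≤ 1) (c : ℤ) (hc : q * c ≤ m * p) :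
    c ≤ F (a+m) - F a := by
  by_contra h
  push Not at h
  have h1 := avg_bounds F q p hp m
  have h2 : ∑ b ∈ Finset.range q, (F (b+m) - F b) < ∑ b ∈ Finset.range q, c := by
    refine Finset.sum_lt_sum (fun b hb' => ?_) ⟨a, Finset.mem_range.2 ha, h⟩
    have := hb b (Finset.mem_range.1 hb')
    linarith
  simp at h2 h1
  linarith

/-- prefix counts for `omegaMinus` -/
def Fm (r : ℚ) (n : ℕ) : ℤ := ⌈((n:ℚ) - 1) * r⌉
/-- prefix counts for `omegaPlus` -/
def Fp (r : ℚ) (n : ℕ) : ℤ := ⌊((n:ℚ) - 1) * r⌋ + 1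

def xm (r : ℚ) (n : ℕ) : Bool := decide (Fm r (n+1) = Fm r n + 1)
def xp (r : ℚ) (n : ℕ) : Bool := decide (Fp r (n+1) = Fp r n + 1)

theorem Fm_zero {r : ℚ} (h0 : 0 < r) (h1 : r < 1) : Fm r 0 = 0 := by
  unfold Fm; rw [Int.ceil_eq_iff]; constructor <;> push_cast <;> linarith

theorem Fp_zero {r : ℚ} (h0 : 0 < r) (h1 : r < 1) : Fp r 0 = 0 := by
  have : ⌊((0:ℕ) - 1 : ℚ) * r⌋ = -1 := by
    rw [Int.floor_eq_iff]; constructor <;> push_cast <;> linarith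
  unfold Fp; rw [this]; rfl

theorem Fm_one (r : ℚ) : Fm r 1 = 0 := by simp [Fm]
theorem Fp_one (r : ℚ) : Fp r 1 = 1 := by simp [Fp]

theorem Fm_bd (r : ℚ) (n : ℕ) : ((n:ℚ) - 1) * r ≤ Fm r n ∧ (Fm r n : ℚ) < ((n:ℚ) - 1) * r + 1 :=
  ⟨Int.le_ceil _, Int.ceil_lt_add_one _⟩

theorem Fp_bd (r : ℚ) (n : ℕ) : ((n:ℚ) - 1) * r < Fp r n ∧ (Fp r n : ℚ) ≤ ((n:ℚ) - 1) * r + 1 := by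
  have h1 := Int.floor_le (((n:ℚ) - 1) * r)
  have h2 := Int.lt_floor_add_one (((n:ℚ) - 1) * r)
  unfold Fp; push_cast; constructor <;> linarith

theorem Fm_step {r : ℚ} (h0 : 0 < r) (h1 : r < 1) (n : ℕ) :
    Fm r (n+1) = Fm r n ∨ Fm r (n+1) = Fm r n + 1 := by
  have a := Fm_bd r n
  have b := Fm_bd r (n+1)
  push_cast at b
  have c1 : (Fm r n : ℚ) < Fm r (n+1) + 1 := by nlinarith
  have c2 : (Fm r (n+1) : ℚ) < Fm r n + 2 := by nlinarith
  have c1' : Fm r n < Fm r (n+1) + 1 := by exact_mod_cast c1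
  have c2' : Fm r (n+1) < Fm r n + 2 := by exact_mod_cast c2
  omega

theorem Fp_step {r : ℚ} (h0 : 0 < r) (h1 : r < 1) (n : ℕ) :
    Fp r (n+1) = Fp r n ∨ Fp r (n+1) = Fp r n + 1 := by
  have a := Fp_bd r n
  have b := Fp_bd r (n+1)
  push_cast at b
  have c1 : (Fp r n : ℚ) < Fp r (n+1) + 1 := by nlinarith
  have c2 : (Fp r (n+1) : ℚ) < Fp r n + 2 := by nlinarith
  have c1' : Fp r n < Fp r (n+1) + 1 := by exact_mod_cast c1
  have c2' : Fp r (n+1) < Fp r n + 2 := by exact_mod_cast c2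
  omega

theorem Fm_per (r : ℚ) (n : ℕ) : Fm r (n + r.den) = Fm r n + r.num := by
  unfold Fm
  rw [← Int.ceil_add_intCast]
  congr 1
  have := Rat.den_mul_eq_num r
  push_cast
  linear_combination this

theorem Fp_per (r : ℚ) (n : ℕ) : Fp r (n + r.den) = Fp r n + r.num := by
  have : ⌊(((n + r.den : ℕ) : ℚ) - 1) * r⌋ = ⌊((n:ℚ) - 1) * r⌋ + r.num := by
    rw [← Int.floor_add_intCast]
    congr 1
    have := Rat.den_mul_eq_num r
    push_cast
    linear_combination this
  unfold Fp
  rw [this]; ring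

theorem Fm_bal (r : ℚ) (a b m : ℕ) :
    (Fm r (a+m) - Fm r a) - (Fm r (b+m) - Fm r b) ≤ 1 := by
  have h1 := Fm_bd r (a+m)
  have h2 := Fm_bd r a
  have h3 := Fm_bd r (b+m)
  have h4 := Fm_bd r b
  push_cast at h1 h3
  have c : ((Fm r (a+m) - Fm r a) - (Fm r (b+m) - Fm r b) : ℚ) < 2 := by linarith
  have c' : (Fm r (a+m) - Fm r a) - (Fm r (b+m) - Fm r b) < 2 := by exact_mod_cast c
  omega

theorem Fp_bal (r : ℚ) (a b m : ℕ) :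
    (Fp r (a+m) - Fp r a) - (Fp r (b+m) - Fp r b) ≤ 1 := by
  have h1 := Fp_bd r (a+m)
  have h2 := Fp_bd r a
  have h3 := Fp_bd r (b+m)
  have h4 := Fp_bd r b
  push_cast at h1 h3
  have c : ((Fp r (a+m) - Fp r a) - (Fp r (b+m) - Fp r b) : ℚ) < 2 := by linarith
  have c' : (Fp r (a+m) - Fp r a) - (Fp r (b+m) - Fp r b) < 2 := by exact_mod_cast c
  omega

theorem cnt_xm {r : ℚ} (h0 : 0 < r) (h1 : r < 1) (n : ℕ) : cnt (xm r) n = Fm r n :=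
  cnt_stair (Fm r) (Fm_zero h0 h1) (Fm_step h0 h1) n

theorem cnt_xp {r : ℚ} (h0 : 0 < r) (h1 : r < 1) (n : ℕ) : cnt (xp r) n = Fp r n :=
  cnt_stair (Fp r) (Fp_zero h0 h1) (Fp_step h0 h1) n

theorem xm_per (r : ℚ) (n : ℕ) : xm r (n + r.den) = xm r n := by
  unfold xm
  rw [show n + r.den + 1 = n + 1 + r.den by ring, Fm_per, Fm_per]
  congr 1
  apply propext
  constructor <;> intro h <;> linarith

theorem xp_per (r : ℚ) (n : ℕ) : xp r (n + r.den) = xp r n := by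
  unfold xp
  rw [show n + r.den + 1 = n + 1 + r.den by ring, Fp_per, Fp_per]
  congr 1
  apply propext
  constructor <;> intro h <;> linarith

theorem Wd_head (x : ℕ → Bool) {q : ℕ} (hq : 0 < q) : (Wd x 0 q).head? = some (x 0) := by
  obtain ⟨k, rfl⟩ := Nat.exists_eq_succ_of_ne_zero hq.ne'
  simp [Wd, List.range_succ_eq_map]

theorem num_toNat {r : ℚ} (h0 : 0 < r) : ((r.num.toNat : ℕ) : ℤ) = r.num :=
  Int.toNat_of_nonneg (Rat.num_nonneg.2 h0.le)

theorem xm_mem {r : ℚ} (h0 : 0 < r) (h1 : r < 1) : Wd (xm r) 0 r.den ∈ OmegaSet r false := by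
  refine ⟨Wd_length _ _ _, ?_, ?_, ?_⟩
  · have := Wd_count (xm r) 0 r.den
    rw [cnt_xm h0 h1, cnt_xm h0 h1, Fm_per] at this
    have h2 := num_toNat h0
    omega
  · rw [cycBalanced_iff _ _ (xm_per r)]
    intro a b m _ _
    simp only [cnt_xm h0 h1]
    exact Fm_bal r a b m
  · rw [Wd_head _ r.den_pos]
    simp [xm, Fm_zero h0 h1, Fm_one]

theorem xp_mem {r : ℚ} (h0 : 0 < r) (h1 : r < 1) : Wd (xp r) 0 r.den ∈ OmegaSet r true := by
  refine ⟨Wd_length _ _ _, ?_, ?_, ?_⟩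
  · have := Wd_count (xp r) 0 r.den
    rw [cnt_xp h0 h1, cnt_xp h0 h1, Fp_per] at this
    have h2 := num_toNat h0
    omega
  · rw [cycBalanced_iff _ _ (xp_per r)]
    intro a b m _ _
    simp only [cnt_xp h0 h1]
    exact Fp_bal r a b m
  · rw [Wd_head _ r.den_pos]
    simp [xp, Fp_zero h0 h1, Fp_one]

/-- unpacking membership in `OmegaSet` -/
theorem omega_unpack {r : ℚ} (h0 : 0 < r) {b : Bool} {v : List Bool} (hv : v ∈ OmegaSet r b) :
    ∃ x : ℕ → Bool, v = Wd x 0 r.den ∧ x 0 = b ∧ (∀ n, cnt x (n + r.den) = cnt x n + r.num) ∧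
      ∀ a b m, a + m ≤ r.den + r.den → b + m ≤ r.den + r.den →
      (cnt x (a+m) - cnt x a) - (cnt x (b+m) - cnt x b) ≤ 1 := by
  obtain ⟨hl, hc, hb, hh⟩ := hv
  have hp : ∀ n, per v (n + r.den) = per v n := by rw [← hl]; exact per_periodic v
  have hw : v = Wd (per v) 0 r.den := by rw [← hl]; exact (Wd_per v).symm
  refine ⟨per v, hw, ?_, ?_, ?_⟩
  · rw [hw, Wd_head _ r.den_pos] at hh
    simpa using hh
  · intro n
    have e := Wd_count (per v) 0 r.den
    rw [← hw, hc, num_toNat h0, zero_add] at e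
    have : cnt (per v) 0 = 0 := by simp [cnt]
    rw [add_comm n, cnt_add]
    have e2 : (fun n => per v (r.den + n)) = per v := by
      funext n; rw [add_comm, hp]
    rw [e2, e, this]; ring
  · rw [hw] at hb
    rwa [cycBalanced_iff _ _ hp] at hb

theorem cnt_one (x : ℕ → Bool) : cnt x 1 = if x 0 then 1 else 0 := by
  unfold cnt; rw [Finset.sum_range_one]

theorem isOmegaMinus_xm {r : ℚ} (h0 : 0 < r) (h1 : r < 1) :
    IsOmegaMinus r (Wd (xm r) 0 r.den) := by
  refine ⟨xm_mem h0 h1, fun v hv => ?_⟩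
  obtain ⟨x, rfl, hx0, hper, hbal⟩ := omega_unpack h0 hv
  apply lex_of_counts_s9
  · simp [Wd_length]
  · intro n hn
    rw [Wd_length] at hn
    have c0 : ∀ y, cnt y 0 = 0 := fun y => by simp [cnt]
    rw [Wd_take _ _ hn, Wd_take _ _ hn, Wd_count, Wd_count, c0, c0, zero_add, cnt_xm h0 h1]
    rcases Nat.eq_zero_or_pos n with rfl | hpos
    · rw [c0, Fm_zero h0 h1]
    · obtain ⟨m, rfl⟩ := Nat.exists_eq_succ_of_ne_zero hpos.ne'
      have hden : 1 < r.den := by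
        by_contra hc
        have hd : r.den = 1 := by have := r.den_pos; omega
        have h3 := Rat.den_mul_eq_num r
        rw [hd] at h3
        have h4 : r = (r.num : ℚ) := by simpa using h3
        rw [h4] at h0 h1
        have h0' : 0 < r.num := by exact_mod_cast h0
        have h1' : r.num < 1 := by exact_mod_cast h1
        omega
      have := bal_upper (cnt x) r.den r.num hper m 1 hden
        (fun b hb => hbal 1 b m (by omega) (by omega)) (Fm r (m+1)) (by
          have h5 := (Fm_bd r (m+1)).1
          have h6 := Rat.den_mul_eq_num r
          have h7 : (0:ℚ) < r.den := by exact_mod_cast r.den_pos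
          have h8 := mul_le_mul_of_nonneg_left h5 h7.le
          push_cast at h8
          have : (m:ℚ) * r.num ≤ r.den * Fm r (m+1) := by
            refine le_trans (le_of_eq ?_) h8
            rw [← h6]; ring
          exact_mod_cast this)
      rw [cnt_one, hx0] at this
      simp only [Nat.succ_eq_add_one]
      rw [add_comm m 1] at *
      simpa using this

theorem isOmegaPlus_xp {r : ℚ} (h0 : 0 < r) (h1 : r < 1) :
    IsOmegaPlus r (Wd (xp r) 0 r.den) := by
  refine ⟨xp_mem h0 h1, fun v hv => ?_⟩
  obtain ⟨x, rfl, hx0, hper, hbal⟩ := omega_unpack h0 hv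
  rw [eq_comm]
  apply lex_of_counts_s9
  · simp [Wd_length]
  · intro n hn
    rw [Wd_length] at hn
    have c0 : ∀ y, cnt y 0 = 0 := fun y => by simp [cnt]
    rw [Wd_take _ _ hn, Wd_take _ _ hn, Wd_count, Wd_count, c0, c0, zero_add, cnt_xp h0 h1]
    rcases Nat.eq_zero_or_pos n with rfl | hpos
    · rw [c0, Fp_zero h0 h1]
    · obtain ⟨m, rfl⟩ := Nat.exists_eq_succ_of_ne_zero hpos.ne'
      have hden : 1 < r.den := by
        by_contra hc
        have hd : r.den = 1 := by have := r.den_pos; omega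
        have h3 := Rat.den_mul_eq_num r
        rw [hd] at h3
        have h4 : r = (r.num : ℚ) := by simpa using h3
        rw [h4] at h0 h1
        have h0' : 0 < r.num := by exact_mod_cast h0
        have h1' : r.num < 1 := by exact_mod_cast h1
        omega
      have := bal_lower (cnt x) r.den r.num hper m 1 hden
        (fun b hb => hbal b 1 m (by omega) (by omega)) (Fp r (m+1) - 1) (by
          have h5 := (Fp_bd r (m+1)).2
          have h6 := Rat.den_mul_eq_num r
          have h7 : (0:ℚ) < r.den := by exact_mod_cast r.den_pos
          have h8 := mul_le_mul_of_nonneg_left h5 h7.le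
          push_cast at h8
          have : (r.den:ℚ) * (Fp r (m+1) - 1) ≤ m * r.num := by
            rw [← h6]; linarith
          exact_mod_cast this)
      rw [cnt_one, hx0] at this
      simp only [Nat.succ_eq_add_one]
      rw [add_comm m 1] at *
      simp at this
      linarith

theorem lex_asymm' {v w : List Bool} (h1 : List.Lex (· < ·) v w) (h2 : List.Lex (· < ·) w v) :
    False := by
  have a : v < w := h1
  have b : w < v := h2
  exact lt_asymm a b

theorem omegaMinus_eq_s9 {r : ℚ} (h0 : 0 < r) (h1 : r < 1) :
    omegaMinus r = Wd (xm r) 0 r.den := by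
  have hx := isOmegaMinus_xm h0 h1
  have hex : ∃ w, IsOmegaMinus r w := ⟨_, hx⟩
  unfold omegaMinus
  rw [dif_pos hex]
  have hc := hex.choose_spec
  rcases hx.2 _ hc.1 with h | h
  · exact h
  rcases hc.2 _ hx.1 with h' | h'
  · exact h'.symm
  exact (lex_asymm' h h').elim

theorem omegaPlus_eq_s9 {r : ℚ} (h0 : 0 < r) (h1 : r < 1) :
    omegaPlus r = Wd (xp r) 0 r.den := by
  have hx := isOmegaPlus_xp h0 h1
  have hex : ∃ w, IsOmegaPlus r w := ⟨_, hx⟩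
  unfold omegaPlus
  rw [dif_pos hex]
  have hc := hex.choose_spec
  rcases hx.2 _ hc.1 with h | h
  · exact h
  rcases hc.2 _ hx.1 with h' | h'
  · exact h'.symm
  exact (lex_asymm' h h').elim

/-- value of a sequence in base `1/β` -/
def Pv (β : ℝ) (x : ℕ → Bool) : ℝ := ∑' n : ℕ, (if x n then (1:ℝ) else 0) * β^(n+1)

/-- value of a finite word in base `1/β` -/
def vl (β : ℝ) : List Bool → ℝ
  | [] => 0
  | b :: w => β * ((if b then (1:ℝ) else 0) + vl β w)

/-- substitution -/
def sub (s t : List Bool) (w : List Bool) : List Bool :=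
  (w.map (fun b => if b then t else s)).flatten

theorem piMap_eq (x : ℕ → Bool) : piMap x = Pv (1/2) x := by
  unfold piMap Pv
  refine tsum_congr fun n => ?_
  rw [div_eq_mul_inv, one_div, inv_pow]

theorem Pv_summable {β : ℝ} (hβ : 0 < β) (hβ2 : β ≤ 1/2) (x : ℕ → Bool) :
    Summable (fun n : ℕ => (if x n then (1:ℝ) else 0) * β^(n+1)) := by
  have hg : Summable (fun k : ℕ => β * β^k) :=
    (summable_geometric_of_lt_one hβ.le (by linarith)).mul_left β
  refine Summable.of_nonneg_of_le (fun k => by positivity) (fun k => ?_) hg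
  have : (0:ℝ) ≤ β^(k+1) := by positivity
  rw [← pow_succ']
  split_ifs <;> linarith

theorem Pv_cons {β : ℝ} (hβ : 0 < β) (hβ2 : β ≤ 1/2) (x : ℕ → Bool) :
    Pv β x = β * ((if x 0 then (1:ℝ) else 0) + Pv β (fun n => x (n+1))) := by
  unfold Pv
  rw [(Pv_summable hβ hβ2 x).tsum_eq_zero_add, mul_add, ← tsum_mul_left]
  congr 1
  · ring
  · refine tsum_congr fun n => ?_
    ring

theorem Pv_cat {β : ℝ} (hβ : 0 < β) (hβ2 : β ≤ 1/2) (w : List Bool) (x : ℕ → Bool) :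
    Pv β (cat w x) = vl β w + β^w.length * Pv β x := by
  induction w with
  | nil => simp [vl]; rfl
  | cons b w ih =>
    rw [Pv_cons hβ hβ2]
    have e : (fun n => cat (b :: w) x (n+1)) = cat w x := by
      funext n; simp [cat]
    rw [e, ih]
    simp only [cat, vl, List.length_cons]
    simp
    ring

theorem cat_per (w : List Bool) : cat w (per w) = per w := by
  funext n
  unfold cat
  split_ifs with h
  · simp [per, Nat.mod_eq_of_lt h]
  · push Not at h
    conv_rhs => rw [← Nat.sub_add_cancel h, per_periodic]

theorem Pv_per {β : ℝ} (hβ : 0 < β) (hβ2 : β ≤ 1/2) (w : List Bool) :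
    Pv β (per w) * (1 - β^w.length) = vl β w := by
  have := Pv_cat hβ hβ2 w (per w)
  rw [cat_per] at this
  linarith

theorem vl_append (β : ℝ) (u w : List Bool) : vl β (u ++ w) = vl β u + β^u.length * vl β w := by
  induction u with
  | nil => simp [vl]
  | cons b u ih => simp only [List.cons_append, vl, ih, List.length_cons]; ring

theorem sub_cons (s t : List Bool) (b : Bool) (w : List Bool) :
    sub s t (b :: w) = (if b then t else s) ++ sub s t w := by simp [sub]

theorem sub_length {s t : List Bool} (h : s.length = t.length) (w : List Bool) :
    (sub s t w).length = s.length * w.length := by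
  induction w with
  | nil => simp [sub]
  | cons b w ih =>
    rw [sub_cons, List.length_append, ih, List.length_cons]
    cases b <;> simp [h] <;> ring

theorem sub_append (s t u w : List Bool) : sub s t (u ++ w) = sub s t u ++ sub s t w := by
  simp [sub]

theorem sbst_comp (s t a b w : List Bool) :
    sub s t (sub a b w) = sub (sub s t a) (sub s t b) w := by
  induction w with
  | nil => simp [sub]
  | cons c w ih => rw [sub_cons, sub_append, ih, sub_cons]; cases c <;> simp

theorem sub_id (w : List Bool) : sub [false] [true] w = w := by
  induction w with
  | nil => simp [sub]
  | cons c w ih => rw [sub_cons, ih]; cases c <;> simp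

theorem substR_eq (r : ℚ) (w : List Bool) : substR r w = sub (omegaMinus r) (omegaPlus r) w := rfl

theorem sWord_snoc (rs : List ℚ) (r : ℚ) :
    sWord (rs ++ [r]) = sub (sWord rs) (tWord rs) (omegaMinus r) := by
  induction rs with
  | nil => simp [sWord, tWord, sub_id, substR]
  | cons a rs ih => simp only [List.cons_append, sWord, tWord, ih, substR_eq, sbst_comp]

theorem tWord_snoc (rs : List ℚ) (r : ℚ) :
    tWord (rs ++ [r]) = sub (sWord rs) (tWord rs) (omegaPlus r) := by
  induction rs with
  | nil => simp [sWord, tWord, sub_id, substR]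
  | cons a rs ih => simp only [List.cons_append, sWord, tWord, ih, substR_eq, sbst_comp]

theorem word_lengths (rs : List ℚ) (h : ∀ r ∈ rs, 0 < r ∧ r < 1) :
    (sWord rs).length = (tWord rs).length ∧ 0 < (sWord rs).length := by
  induction rs with
  | nil => simp [sWord, tWord]
  | cons a rs ih =>
    obtain ⟨h0, h1⟩ := h a (by simp)
    obtain ⟨ih1, ih2⟩ := ih (fun r hr => h r (by simp [hr]))
    have hl : (omegaMinus a).length = (omegaPlus a).length := by
      rw [omegaMinus_eq_s9 h0 h1, omegaPlus_eq_s9 h0 h1, Wd_length, Wd_length]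
    have hl2 : 0 < (omegaMinus a).length := by
      rw [omegaMinus_eq_s9 h0 h1, Wd_length]; exact a.den_pos
    simp only [sWord, tWord, substR_eq, sub_length hl, ih1]
    exact ⟨trivial, Nat.mul_pos hl2 (ih1 ▸ ih2)⟩

section values
variable (s t : List Bool)

/-- contraction ratio -/
def Bq : ℝ := (1/2)^s.length
/-- slope -/
def Dq : ℝ := (vl (1/2) t - vl (1/2) s) / Bq s
/-- offset -/
def Kq : ℝ := vl (1/2) s / (1 - Bq s)

end values

theorem Bq_pos (s : List Bool) : 0 < Bq s := by unfold Bq; positivity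

theorem Bq_le {s : List Bool} (hs : 0 < s.length) : Bq s ≤ 1/2 := by
  unfold Bq
  calc (1/2:ℝ)^s.length ≤ (1/2)^1 := pow_le_pow_of_le_one (by norm_num) (by norm_num) hs
    _ = 1/2 := by norm_num

theorem vl_sub {s t : List Bool} (h : s.length = t.length) (hs : 0 < s.length) (w : List Bool) :
    vl (1/2) (sub s t w) = Kq s * (1 - (Bq s)^w.length) + Dq s t * vl (Bq s) w := by
  have hB := Bq_pos s
  have hB2 := Bq_le hs
  have hK : vl (1/2) s = Kq s * (1 - Bq s) := by
    unfold Kq; rw [div_mul_cancel₀]; linarith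
  have hD : vl (1/2) t = Kq s * (1 - Bq s) + Dq s t * Bq s := by
    unfold Dq; rw [div_mul_cancel₀ _ hB.ne', ← hK]; ring
  induction w with
  | nil => simp [sub, vl]
  | cons b w ih =>
    rw [sub_cons, vl_append, ih]
    have e : (1/2:ℝ)^(if b then t else s).length = Bq s := by
      unfold Bq; cases b <;> simp [h]
    rw [e]
    simp only [vl, List.length_cons]
    cases b
    · simp [-one_div]; rw [hK]; ring
    · simp [-one_div]; rw [hD]; ring

theorem val_per {s t : List Bool} (h : s.length = t.length) (hs : 0 < s.length) (w : List Bool)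
    (hw : 0 < w.length) :
    piMap (per (sub s t w)) = Kq s + Dq s t * Pv (Bq s) (per w) := by
  have hB := Bq_pos s
  have hB2 := Bq_le hs
  have h1 := Pv_per (β := 1/2) (by norm_num) le_rfl (sub s t w)
  have h2 := Pv_per hB hB2 w
  rw [vl_sub h hs, ← h2, sub_length h, pow_mul] at h1
  change _ * (1 - (Bq s)^w.length) = _ at h1
  have hlt : (Bq s)^w.length < 1 := pow_lt_one₀ hB.le (by linarith) hw.ne'
  rw [piMap_eq]
  refine mul_right_cancel₀ (b := 1 - (Bq s)^w.length) (by linarith) ?_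
  rw [h1]; ring

theorem val_cat {s t : List Bool} (h : s.length = t.length) (hs : 0 < s.length) (w : List Bool)
    (x y : ℕ → Bool) (hx : piMap x = Kq s + Dq s t * Pv (Bq s) y) :
    piMap (cat (sub s t w) x) = Kq s + Dq s t * Pv (Bq s) (cat w y) := by
  have hB := Bq_pos s
  have hB2 := Bq_le hs
  rw [piMap_eq, Pv_cat (by norm_num) le_rfl, ← piMap_eq, hx, vl_sub h hs, sub_length h, pow_mul,
    Pv_cat hB hB2]
  change _ + (Bq s)^w.length * _ = _
  ring

theorem sub_false (s t : List Bool) : sub s t [false] = s := by simp [sub]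
theorem sub_true (s t : List Bool) : sub s t [true] = t := by simp [sub]

theorem cnt_nonneg (x : ℕ → Bool) (n : ℕ) : 0 ≤ cnt x n ∧ cnt x n ≤ n := by
  unfold cnt
  constructor
  · exact Finset.sum_nonneg fun i _ => by split_ifs <;> norm_num
  · calc _ ≤ ∑ i ∈ Finset.range n, (1:ℤ) := Finset.sum_le_sum fun i _ => by split_ifs <;> norm_num
      _ = n := by simp

theorem Pv_abel {β : ℝ} (hβ : 0 < β) (hβ2 : β ≤ 1/2) (x : ℕ → Bool) (h1 : cnt x 1 = 0) :
    Pv β x = (1-β) * ∑' k : ℕ, (cnt x (k+2) : ℝ) * β^(k+2) := by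
  have hs : Summable (fun k : ℕ => (cnt x (k+2) : ℝ) * β^(k+2)) := by
    refine coef_summable hβ hβ2 _ (fun k => ?_) (fun k => ?_)
    · exact_mod_cast (cnt_nonneg x _).1
    · exact_mod_cast (cnt_nonneg x (k+2)).2
  have hs1 : Summable (fun k : ℕ => (cnt x (k+1) : ℝ) * β^(k+1)) :=
    (summable_nat_add_iff (f := fun k : ℕ => (cnt x (k+1) : ℝ) * β^(k+1)) 1).1 hs
  have hs0 : Summable (fun k : ℕ => (cnt x k : ℝ) * β^k) :=
    (summable_nat_add_iff (f := fun k : ℕ => (cnt x k : ℝ) * β^k) 1).1 hs1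
  have e1 : ∑' k : ℕ, (cnt x (k+1) : ℝ) * β^(k+1) = ∑' k : ℕ, (cnt x (k+2) : ℝ) * β^(k+2) := by
    rw [hs1.tsum_eq_zero_add]; simp [h1]
  have e0 : ∑' k : ℕ, (cnt x k : ℝ) * β^k = ∑' k : ℕ, (cnt x (k+1) : ℝ) * β^(k+1) := by
    rw [hs0.tsum_eq_zero_add]; simp [cnt]
  have e2 : Pv β x = ∑' k : ℕ, (cnt x (k+1) : ℝ) * β^(k+1) - β * ∑' k : ℕ, (cnt x k : ℝ) * β^k := by
    rw [← tsum_mul_left, ← hs1.tsum_sub (hs0.mul_left β)]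
    unfold Pv
    refine tsum_congr fun k => ?_
    have : cnt x (k+1) = cnt x k + if x k then 1 else 0 := by
      unfold cnt; rw [Finset.sum_range_succ]
    rw [this]; push_cast
    ring
  rw [e2, e0, e1]; ring

theorem den_gt_one {r : ℚ} (h0 : 0 < r) (h1 : r < 1) : 1 < r.den := by
  by_contra hc
  have hd : r.den = 1 := by have := r.den_pos; omega
  have h3 := Rat.den_mul_eq_num r
  rw [hd] at h3
  have h4 : r = (r.num : ℚ) := by simpa using h3
  rw [h4] at h0 h1
  have h0' : 0 < r.num := by exact_mod_cast h0
  have h1' : r.num < 1 := by exact_mod_cast h1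
  omega

theorem Pv_left {β : ℝ} (hβ : 0 < β) (hβ2 : β ≤ 1/2) {r : ℚ} (h0 : 0 < r) (h1 : r < 1) :
    Pv β (per (omegaMinus r)) = Lf β r := by
  rw [omegaMinus_eq_s9 h0 h1, per_Wd _ r.den_pos (xm_per r), Pv_abel hβ hβ2]
  · unfold Lf
    congr 1
    refine tsum_congr fun k => ?_
    rw [cnt_xm h0 h1]
    unfold Fm
    congr 4
    push_cast; ring
  · rw [cnt_xm h0 h1, Fm_one]

theorem cnt_cat_le (w : List Bool) (x : ℕ → Bool) {n : ℕ} (hn : n ≤ w.length) :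
    cnt (cat w x) n = cnt (per w) n := by
  unfold cnt
  refine Finset.sum_congr rfl fun i hi => ?_
  have hi' : i < w.length := lt_of_lt_of_le (Finset.mem_range.1 hi) hn
  simp [cat, per, hi', Nat.mod_eq_of_lt hi']

theorem cnt_cat_add (w : List Bool) (x : ℕ → Bool) (n : ℕ) :
    cnt (cat w x) (w.length + n) = cnt (per w) w.length + cnt x n := by
  rw [cnt_add, cnt_cat_le w x le_rfl]
  congr 2
  funext i
  simp [cat]

theorem Fm_eq_Fp {r : ℚ} {n : ℕ} (h2 : 2 ≤ n) (hn : n ≤ r.den) :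
    Fm r n = Fp r n := by
  have a := Fm_bd r n
  have b := Fp_bd r n
  have c1 : (Fm r n : ℚ) < Fp r n + 1 := by linarith
  have c2 : (Fp r n : ℚ) ≤ Fm r n + 1 := by linarith
  have c1' : Fm r n < Fp r n + 1 := by exact_mod_cast c1
  have c2' : Fp r n ≤ Fm r n + 1 := by exact_mod_cast c2
  by_contra hne
  have he : Fp r n = Fm r n + 1 := by omega
  have he' : (Fp r n : ℚ) = Fm r n + 1 := by exact_mod_cast he
  have hint : ((n:ℚ) - 1) * r = Fm r n := by linarith
  obtain ⟨m, rfl⟩ : ∃ m, n = m + 1 := ⟨n - 1, by omega⟩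
  push_cast at hint
  have h6 := Rat.den_mul_eq_num r
  have h7 : ((m:ℤ):ℚ) * r.num = r.den * Fm r (m+1) := by
    rw [← hint, ← h6]; push_cast; ring
  have h8 : (m:ℤ) * r.num = r.den * Fm r (m+1) := by exact_mod_cast h7
  have h9 : (r.den : ℤ) ∣ (m:ℤ) * r.num := ⟨_, h8⟩
  have h10 : IsCoprime (r.den : ℤ) r.num := by
    rw [Int.isCoprime_iff_gcd_eq_one, Int.gcd_comm]
    exact r.reduced
  have h11 := h10.dvd_of_dvd_mul_right h9
  have h12 : r.den ∣ m := by exact_mod_cast h11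
  have := Nat.le_of_dvd (by omega) h12
  omega

theorem Pv_right {β : ℝ} (hβ : 0 < β) (hβ2 : β ≤ 1/2) {r : ℚ} (h0 : 0 < r) (h1 : r < 1) :
    Pv β (cat (omegaMinus r) (per (omegaPlus r))) = Rf β r := by
  have hd := den_gt_one h0 h1
  have hlen : (omegaMinus r).length = r.den := by rw [omegaMinus_eq_s9 h0 h1, Wd_length]
  have hpm : per (omegaMinus r) = xm r := by
    rw [omegaMinus_eq_s9 h0 h1, per_Wd _ r.den_pos (xm_per r)]
  have hpp : per (omegaPlus r) = xp r := by
    rw [omegaPlus_eq_s9 h0 h1, per_Wd _ r.den_pos (xp_per r)]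
  have key : ∀ n, 2 ≤ n → cnt (cat (omegaMinus r) (per (omegaPlus r))) n = Fp r n := by
    intro n hn
    rcases le_total n r.den with h | h
    · rw [cnt_cat_le _ _ (hlen ▸ h), hpm, cnt_xm h0 h1, Fm_eq_Fp hn h]
    · obtain ⟨j, rfl⟩ := Nat.exists_eq_add_of_le h
      have e := cnt_cat_add (omegaMinus r) (per (omegaPlus r)) j
      rw [hlen] at e
      have e2 := Fm_per r 0
      rw [Fm_zero h0 h1, zero_add, zero_add] at e2
      rw [e, hpm, hpp, cnt_xm h0 h1, cnt_xp h0 h1, e2, add_comm r.den, Fp_per, add_comm]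
  rw [Pv_abel hβ hβ2]
  · unfold Rf
    congr 1
    refine tsum_congr fun k => ?_
    rw [key _ (by omega)]
    unfold Fp
    push_cast
    congr 5
    ring
  · rw [cnt_cat_le _ _ (by omega), hpm, cnt_xm h0 h1, Fm_one]

theorem Pv_bot {β : ℝ} (hβ : 0 < β) (hβ2 : β ≤ 1/2) :
    Pv β (cat [false] (cat [true] (per [false]))) = Rf β 0 := by
  have hc : ∀ n, cnt (per [false]) n = 0 := by
    intro n; simp [cnt, per, Nat.mod_one]
  have h1 := Pv_abel hβ hβ2 (cat [false] (cat [true] (per [false])))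
    (by simp [cnt_one, cat])
  rw [h1]
  unfold Rf
  congr 1
  refine tsum_congr fun k => ?_
  have e1 := cnt_cat_add [false] (cat [true] (per [false])) (k+1)
  have e2 := cnt_cat_add [true] (per [false]) k
  simp only [List.length_singleton] at e1 e2
  rw [show k + 2 = 1 + (k+1) by ring, e1, add_comm k 1, e2, hc, hc]
  simp [cnt_one, per]

theorem Pv_top {β : ℝ} (hβ : 0 < β) (hβ2 : β ≤ 1/2) :
    Pv β (cat [false] (per [true])) = Lf β 1 := by
  have hc : ∀ n, cnt (per [true]) n = n := by
    intro n; simp [cnt, per, Nat.mod_one]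
  have h1 := Pv_abel hβ hβ2 (cat [false] (per [true]))
    (by simp [cnt_one, cat])
  rw [h1]
  unfold Lf
  congr 1
  refine tsum_congr fun k => ?_
  have e1 := cnt_cat_add [false] (per [true]) (k+1)
  simp only [List.length_singleton] at e1
  rw [show k + 2 = 1 + (k+1) by ring, e1, hc]
  have : ⌈((k:ℚ)+1) * 1⌉ = (k:ℤ) + 1 := by
    rw [mul_one]
    exact_mod_cast Int.ceil_natCast (R := ℚ) (k+1)
  rw [this]
  simp [cnt_one, per]

theorem dimH_Sn (rs : List ℚ) (hrs : ∀ r ∈ rs, 0 < r ∧ r < 1) : dimH (Sn rs) = 0 := by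
  obtain ⟨hl, hs⟩ := word_lengths rs hrs
  set s := sWord rs with hsd
  set t := tWord rs with htd
  have hB := Bq_pos s
  have hB2 := Bq_le hs
  have ps : piMap (per s) = Kq s + Dq s t * Pv (Bq s) (per [false]) := by
    conv_lhs => rw [← sub_false s t]
    exact val_per hl hs _ (by simp)
  have pt : piMap (per t) = Kq s + Dq s t * Pv (Bq s) (per [true]) := by
    conv_lhs => rw [← sub_true s t]
    exact val_per hl hs _ (by simp)
  have top : piMap (cat s (per t)) = Kq s + Dq s t * Lf (Bq s) 1 := by
    rw [← Pv_top hB hB2]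
    have := val_cat hl hs [false] _ _ pt
    rwa [sub_false] at this
  have bot : piMap (cat s (cat t (per s))) = Kq s + Dq s t * Rf (Bq s) 0 := by
    rw [← Pv_bot hB hB2]
    have := val_cat hl hs [true] _ _ ps
    rw [sub_true] at this
    have := val_cat hl hs [false] _ _ this
    rwa [sub_false] at this
  have hdel : ∀ r : ℚ, 0 < r → r < 1 → DeltaI (rs ++ [r]) =
      Set.Icc (Kq s + Dq s t * Lf (Bq s) r) (Kq s + Dq s t * Rf (Bq s) r) := by
    intro r h0 h1
    have hm : 0 < (omegaMinus r).length := by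
      rw [omegaMinus_eq_s9 h0 h1, Wd_length]; exact r.den_pos
    have hp : 0 < (omegaPlus r).length := by
      rw [omegaPlus_eq_s9 h0 h1, Wd_length]; exact r.den_pos
    unfold DeltaI
    rw [sWord_snoc, tWord_snoc, ← hsd, ← htd, val_per hl hs _ hm,
      val_cat hl hs _ _ _ (val_per hl hs _ hp), Pv_left hB hB2 h0 h1, Pv_right hB hB2 h0 h1]
  have htil : DeltaTilde rs =
      Set.Icc (Kq s + Dq s t * Rf (Bq s) 0) (Kq s + Dq s t * Lf (Bq s) 1) := by
    unfold DeltaTilde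
    rw [← hsd, ← htd, top, bot]
  have hRL : Rf (Bq s) 0 ≤ Lf (Bq s) 1 := by
    unfold Rf Lf
    refine mul_le_mul_of_nonneg_left ?_ (by linarith)
    refine Summable.tsum_le_tsum (fun k => ?_) ?_ ?_
    · refine mul_le_mul_of_nonneg_right ?_ (by positivity)
      have : ⌈((k:ℚ)+1) * 1⌉ = (k:ℤ) + 1 := by
        rw [mul_one]
        exact_mod_cast Int.ceil_natCast (R := ℚ) (k+1)
      rw [this]; simp
    · exact coef_summable hB hB2 _ (fun k => by linarith [(Rf_coef le_rfl zero_le_one k).1])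
        (fun k => by linarith [(Rf_coef le_rfl zero_le_one k).2])
    · exact coef_summable hB hB2 _ (fun k => (Lf_coef zero_le_one le_rfl k).1)
        (fun k => by linarith [(Lf_coef zero_le_one le_rfl k).2])
  rcases le_or_gt (Dq s t) 0 with hD | hD
  · apply dimH_subsingleton
    intro x hx y hy
    have hx := hx.1
    have hy := hy.1
    rw [htil] at hx hy
    have : Dq s t * Lf (Bq s) 1 ≤ Dq s t * Rf (Bq s) 0 := mul_le_mul_of_nonpos_left hRL hD
    linarith [hx.1, hx.2, hy.1, hy.2]
  · have hsub : Sn rs ⊆ (fun y => Kq s + Dq s t * y) '' Eset (Bq s) := by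
      rintro x ⟨hx1, hx2⟩
      rw [htil] at hx1
      have hxe : Kq s + Dq s t * ((x - Kq s) / Dq s t) = x := by
        field_simp; ring
      refine ⟨(x - Kq s) / Dq s t, ⟨?_, ?_, ?_⟩, hxe⟩
      · rw [le_div_iff₀ hD]; linarith [hx1.1]
      · rw [div_le_iff₀ hD]; linarith [hx1.2]
      · rintro r h0 h1 ⟨ha, hb⟩
        apply hx2
        refine Set.mem_iUnion₂.2 ⟨r, ⟨h0, h1⟩, ?_⟩
        rw [hdel r h0 h1]
        rw [le_div_iff₀ hD] at ha
        rw [div_le_iff₀ hD] at hb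
        exact ⟨by linarith, by linarith⟩
    have hlip : LipschitzWith (Real.toNNReal |Dq s t|) (fun y => Kq s + Dq s t * y) := by
      refine LipschitzWith.of_dist_le_mul fun a b => ?_
      rw [Real.coe_toNNReal _ (abs_nonneg _), Real.dist_eq, Real.dist_eq, ← abs_mul]
      apply le_of_eq; congr 1; ring
    rw [← nonpos_iff_eq_zero]
    calc dimH (Sn rs) ≤ _ := dimH_mono hsub
      _ ≤ dimH (Eset (Bq s)) := hlip.dimH_image_le _
      _ = 0 := dimH_Eset hB hB2

theorem Scal_subset : Scal ⊆ Sn [] := by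
  have hf : Pv (1/2) (per [false]) = 0 := by
    have := Pv_per (β := 1/2) (by norm_num) le_rfl [false]
    norm_num [vl] at this
    simpa using this
  have ht : Pv (1/2) (per [true]) = 1 := by
    have := Pv_per (β := 1/2) (by norm_num) le_rfl [true]
    norm_num [vl] at this
    norm_num
    linarith
  rintro x ⟨hx1, hx2⟩
  refine ⟨?_, hx2⟩
  unfold DeltaTilde
  simp only [sWord, tWord, piMap_eq]
  rw [Pv_cat (by norm_num) le_rfl, Pv_cat (by norm_num) le_rfl, Pv_cat (by norm_num) le_rfl, hf, ht]
  norm_num [vl]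
  constructor <;> linarith [hx1.1, hx1.2]

theorem stmt9 :
    (∀ rs : List ℚ, 1 ≤ rs.length → (∀ r ∈ rs, 0 < r ∧ r < 1) → dimH (Sn rs) = 0) ∧
    dimH bigS = 0 := by
  refine ⟨fun rs _ h => dimH_Sn rs h, ?_⟩
  unfold bigS
  rw [dimH_union, dimH_bUnion (Set.to_countable _)]
  have h1 : dimH Scal = 0 := by
    rw [← nonpos_iff_eq_zero]
    exact (dimH_mono Scal_subset).trans (dimH_Sn [] (by simp)).le
  rw [h1, ← nonpos_iff_eq_zero]
  refine max_le le_rfl (iSup₂_le fun rs hrs => ?_)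
  exact (dimH_Sn rs hrs.2).le

end
end
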